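/- Let Γ be a distance-regular graph with classical parameters (D, b, α, β) such that b ≥ 2 and D ≥ 3, and let r = [D]. If β ≥ max{ ((2b+4)/(2b+3))·r(b+2)(αb + b + α), ((2b+4)/(2b+3))·r((b+1)(b² + b + 2) − 3) }, then Γ is geometric. -/

import Mathlib

open SimpleGraph

namespace DRGPaper

variable {V : Type*}

/-- `Γ` is a distance-regular graph with diameter `D` and intersection arrays `cc`, `aa`, `bb`:
`Γ` is connected of diameter `D` and for any vertices `x, y` at distance `i ≤ D`, `y` has exactly
`cc i` neighbours at distance `i - 1` from `x`, `aa i` neighbours at distance `i` from `x`,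
and `bb i` neighbours at distance `i + 1` from `x`. -/
def IsDRG [Fintype V] (G : SimpleGraph V) (D : ℕ) (cc aa bb : ℕ → ℕ) : Prop :=
  G.Connected ∧
  (∀ x y : V, G.dist x y ≤ D) ∧
  (∃ x y : V, G.dist x y = D) ∧
  ∀ i : ℕ, i ≤ D → ∀ x y : V, G.dist x y = i →
    {z : V | G.Adj y z ∧ G.dist x z = i - 1}.ncard = cc i ∧
    {z : V | G.Adj y z ∧ G.dist x z = i}.ncard = aa i ∧
    {z : V | G.Adj y z ∧ G.dist x z = i + 1}.ncard = bb i

/-- `[j] = (b^j - 1)/(b - 1) = 1 + b + ⋯ + b^(j-1)` as a real number. -/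
def gauss (b j : ℕ) : ℝ := ∑ i ∈ Finset.range j, (b : ℝ) ^ i

/-- `Γ` has classical parameters `(D, b, α, β)`: it is distance-regular of diameter `D` with
`bb i = ([D] - [i])(β - α[i])` for `0 ≤ i ≤ D - 1` and `cc i = [i](1 + α[i-1])` for
`1 ≤ i ≤ D`. -/
def HasClassicalParams [Fintype V] (G : SimpleGraph V) (D b : ℕ) (α β : ℝ)
    (cc aa bb : ℕ → ℕ) : Prop :=
  IsDRG G D cc aa bb ∧
  (∀ i : ℕ, i ≤ D - 1 → (bb i : ℝ) = (gauss b D - gauss b i) * (β - α * gauss b i)) ∧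
  (∀ i : ℕ, 1 ≤ i → i ≤ D → (cc i : ℝ) = gauss b i * (1 + α * gauss b (i - 1)))

/-- `d(x, C) = min {d(x, y) : y ∈ C}`. -/
noncomputable def distToSet (G : SimpleGraph V) (x : V) (C : Set V) : ℕ :=
  sInf (G.dist x '' C)

/-- A maximal clique of `G`. -/
def IsMaxClique (G : SimpleGraph V) (s : Set V) : Prop :=
  G.IsClique s ∧ ∀ t : Set V, G.IsClique t → s ⊆ t → t = s

/-- The lines for the PLS(γ) property: maximal cliques with at least `γ` vertices. -/
def plsLines (G : SimpleGraph V) (γ : ℕ) : Set (Set V) :=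
  {ℓ : Set V | IsMaxClique G ℓ ∧ γ ≤ ℓ.ncard}

/-- `G` is the point graph of the partial linear space with line set `L`: any two adjacent
vertices lie on exactly one common line of `L`. -/
def IsPointGraphOf (G : SimpleGraph V) (L : Set (Set V)) : Prop :=
  ∀ x y : V, G.Adj x y → ∃! ℓ : Set V, ℓ ∈ L ∧ x ∈ ℓ ∧ y ∈ ℓ

/-- A vertex is a Delsarte vertex (w.r.t. the line set `L` and classical parameter `β`) if all
lines through it have exactly `β + 1` vertices. -/
def IsDelsarteVertex (L : Set (Set V)) (β : ℝ) (x : V) : Prop :=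
  ∀ ℓ ∈ L, x ∈ ℓ → (ℓ.ncard : ℝ) = β + 1

/-- The lines for the SPLS(c, s) property: maximal cliques with at least
`a1 + 2 - (c - 1)(s - 1)` vertices. -/
def splsLines (G : SimpleGraph V) (a1 c s : ℕ) : Set (Set V) :=
  {ℓ : Set V | IsMaxClique G ℓ ∧ (a1 : ℤ) + 2 - ((c : ℤ) - 1) * ((s : ℤ) - 1) ≤ (ℓ.ncard : ℤ)}

/-- The SPLS(c, s) property: `G` is the point graph of the partial linear space whose lines are
the maximal cliques with at least `a1 + 2 - (c-1)(s-1)` vertices, `a1 ≥ (2s-1)(c-1)`, each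
vertex lies on at most `s` lines, and every point not on a line `ℓ` is collinear with at most
`c` points of `ℓ`.  SPLS(s) is the case `c = c₂`. -/
def HasSPLS (G : SimpleGraph V) (a1 c s : ℕ) : Prop :=
  1 ≤ c ∧ 2 ≤ s ∧
  (2 * (s : ℤ) - 1) * ((c : ℤ) - 1) ≤ (a1 : ℤ) ∧
  IsPointGraphOf G (splsLines G a1 c s) ∧
  (∀ x : V, {ℓ ∈ splsLines G a1 c s | x ∈ ℓ}.ncard ≤ s) ∧
  (∀ ℓ ∈ splsLines G a1 c s, ∀ x : V, x ∉ ℓ → {y ∈ ℓ | G.Adj x y}.ncard ≤ c)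

/-- `[x, y]`: the set of lines `ℓ ∈ L` through `x` such that `d(y, u) ≤ 2` for all `u ∈ ℓ`. -/
def lineXY (G : SimpleGraph V) (L : Set (Set V)) (x y : V) : Set (Set V) :=
  {ℓ ∈ L | x ∈ ℓ ∧ ∀ u ∈ ℓ, G.dist y u ≤ 2}

/-- `𝓒` witnesses that `G` is geometric with cliques of order `q`: every member of `𝓒` is a
clique with exactly `q` vertices and every edge of `G` lies in a unique member of `𝓒`. -/
def IsGeomLineSet (G : SimpleGraph V) (q : ℝ) (𝓒 : Set (Set V)) : Prop :=
  (∀ C ∈ 𝓒, G.IsClique C ∧ (C.ncard : ℝ) = q) ∧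
  ∀ x y : V, G.Adj x y → ∃! C : Set V, C ∈ 𝓒 ∧ x ∈ C ∧ y ∈ C

/-- `G` is geometric: there is a set of Delsarte cliques (cliques of the maximum order `q`)
such that every edge lies in a unique member. -/
def IsGeometric (G : SimpleGraph V) (q : ℝ) : Prop :=
  ∃ 𝓒 : Set (Set V), IsGeomLineSet G q 𝓒

/-- An assembly: a maximal clique which is not a line. -/
def IsAssembly (G : SimpleGraph V) (𝓒 : Set (Set V)) (M : Set V) : Prop :=
  IsMaxClique G M ∧ M ∉ 𝓒

/-- The dual Pasch axiom: for every pair of adjacent vertices `x, y`, the common neighbours of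
`x` and `y` outside the (any) line of `𝓒` through `x` and `y` form a clique. -/
def DualPasch (G : SimpleGraph V) (𝓒 : Set (Set V)) : Prop :=
  ∀ x y : V, G.Adj x y → ∀ ℓ ∈ 𝓒, x ∈ ℓ → y ∈ ℓ →
    G.IsClique {z : V | G.Adj x z ∧ G.Adj y z ∧ z ∉ ℓ}

/-- The `m × n` grid, i.e. the Cartesian product `K_m □ K_n`. -/
def gridGraph (m n : ℕ) : SimpleGraph (Fin m × Fin n) :=
  (⊤ : SimpleGraph (Fin m)).boxProd (⊤ : SimpleGraph (Fin n))

/-- The `A`-clique extension of a graph `H`: replace every vertex of `H` by a clique of size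
`A`, vertices in distinct cliques being adjacent exactly when the underlying vertices of `H`
are adjacent. -/
def cliqueExt {W : Type*} (H : SimpleGraph W) (A : ℕ) : SimpleGraph (W × Fin A) :=
  SimpleGraph.fromRel (fun p q => H.Adj p.1 q.1 ∨ p.1 = q.1)

/-- `θ` is an eigenvalue of the adjacency matrix of `G`. -/
def IsAdjEigenvalue [Fintype V] (G : SimpleGraph V) [DecidableRel G.Adj] (θ : ℝ) : Prop :=
  ∃ v : V → ℝ, v ≠ 0 ∧ (G.adjMatrix ℝ).mulVec v = θ • v

section LineSystems

open scoped Classical in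
/-- A line system of `G`: a family of maximal cliques such that every edge lies in exactly one. -/
structure IsLineSystem (G : SimpleGraph V) (L : Finset (Finset V)) : Prop where
  adj : ∀ ℓ ∈ L, ∀ x ∈ ℓ, ∀ y ∈ ℓ, x ≠ y → G.Adj x y
  exists_line : ∀ x y, G.Adj x y → ∃ ℓ ∈ L, x ∈ ℓ ∧ y ∈ ℓ
  unique : ∀ ℓ ∈ L, ∀ ℓ' ∈ L, ∀ x y, x ≠ y → x ∈ ℓ → y ∈ ℓ → x ∈ ℓ' → y ∈ ℓ' → ℓ = ℓ'
  exists_not_adj : ∀ ℓ ∈ L, ∀ x, x ∉ ℓ → ∃ y ∈ ℓ, ¬ G.Adj x y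

variable [Fintype V] (G : SimpleGraph V)

open scoped Classical in
/-- The common neighbours of two vertices. -/
noncomputable def commonNbrs (x y : V) : Finset V :=
  Finset.univ.filter fun z => G.Adj x z ∧ G.Adj y z

variable {G} {k lam c s : ℕ}

theorem mem_commonNbrs {x y z : V} : z ∈ commonNbrs G x y ↔ G.Adj x z ∧ G.Adj y z := by
  simp [commonNbrs]

open scoped Classical in
/-- Neighbours of two nonadjacent neighbours `z, w` of `x`, not counting `x`. -/
theorem card_le_of_subset_commonNbrs
    (hmu : ∀ x y, x ≠ y → ¬ G.Adj x y → (commonNbrs G x y).card ≤ c + 1)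
    {x z w : V} (hxz : G.Adj x z) (hxw : G.Adj x w) (hne : z ≠ w) (hzw : ¬ G.Adj z w)
    {A : Finset V} (hA : ∀ p ∈ A, p ≠ x ∧ G.Adj z p ∧ G.Adj w p) : A.card ≤ c := by
  have h1 : insert x A ⊆ commonNbrs G z w := by
    intro p hp
    rw [Finset.mem_insert] at hp
    rw [mem_commonNbrs]
    rcases hp with rfl | hp
    · exact ⟨hxz.symm, hxw.symm⟩
    · exact (hA p hp).2
  have h2 : x ∉ A := fun hx => (hA x hx).1 rfl
  have h3 := (Finset.card_le_card h1).trans (hmu z w hne hzw)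
  rw [Finset.card_insert_of_notMem h2] at h3
  omega

open scoped Classical in
theorem two_mul_card_biUnion_ge
    (hlam : ∀ x y, G.Adj x y → (commonNbrs G x y).card = lam)
    (hmu : ∀ x y, x ≠ y → ¬ G.Adj x y → (commonNbrs G x y).card ≤ c + 1)
    (x : V) (I : Finset V) (hI : ∀ z ∈ I, G.Adj x z)
    (hco : ∀ z ∈ I, ∀ w ∈ I, ¬ G.Adj z w) :
    2 * I.card * (lam + 1) + c * I.card ≤
      2 * (I.biUnion fun z => insert z (commonNbrs G x z)).card + c * I.card * I.card := by
  induction I using Finset.induction_on with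
  | empty => simp
  | insert z J hz ih =>
    have ih' := ih (fun w hw => hI w (Finset.mem_insert_of_mem hw))
      (fun w hw v hv => hco w (Finset.mem_insert_of_mem hw) v (Finset.mem_insert_of_mem hv))
    rw [Finset.biUnion_insert, Finset.card_insert_of_notMem hz]
    have hxz := hI z (Finset.mem_insert_self _ _)
    set U := J.biUnion fun z => insert z (commonNbrs G x z) with hU
    have hcz : (insert z (commonNbrs G x z)).card = lam + 1 := by
      rw [Finset.card_insert_of_notMem, hlam x z hxz]
      simp [mem_commonNbrs]
    have hint : (insert z (commonNbrs G x z) ∩ U).card ≤ J.card * c := by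
      rw [hU, Finset.inter_biUnion]
      refine Finset.card_biUnion_le_card_mul _ _ _ fun w hw => ?_
      have hwJ : w ∈ insert z J := Finset.mem_insert_of_mem hw
      have hxw := hI w hwJ
      have hne : z ≠ w := fun h => hz (h ▸ hw)
      have hzw := hco z (Finset.mem_insert_self _ _) w hwJ
      refine card_le_of_subset_commonNbrs hmu hxz hxw hne hzw fun p hp => ?_
      simp only [Finset.mem_inter, Finset.mem_insert, mem_commonNbrs] at hp
      obtain ⟨h1 | h1, h2 | h2⟩ := hp
      · exact absurd (h1 ▸ h2) hne
      · exact absurd (h1 ▸ h2.2.symm) hzw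
      · exact absurd (h2 ▸ h1.2) hzw
      · exact ⟨h1.1.ne', h1.2, h2.2⟩
    have hun := Finset.card_union_add_card_inter (insert z (commonNbrs G x z)) U
    rw [hcz] at hun
    nlinarith

open scoped Classical in
theorem coclique_card_le
    (hdeg : ∀ x, (Finset.univ.filter fun z => G.Adj x z).card = k)
    (hlam : ∀ x y, G.Adj x y → (commonNbrs G x y).card = lam)
    (hmu : ∀ x y, x ≠ y → ¬ G.Adj x y → (commonNbrs G x y).card ≤ c + 1)
    (h1 : 2 * k + s * (s + 1) * c < 2 * (s + 1) * (lam + 1))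
    (x : V) (I : Finset V) (hI : ∀ z ∈ I, G.Adj x z)
    (hco : ∀ z ∈ I, ∀ w ∈ I, ¬ G.Adj z w) : I.card ≤ s := by
  by_contra! hcon
  obtain ⟨J, hJI, hJ⟩ := Finset.exists_subset_card_eq (show s + 1 ≤ I.card from hcon)
  have h := two_mul_card_biUnion_ge hlam hmu x J (fun z hz => hI z (hJI hz))
    (fun z hz w hw => hco z (hJI hz) w (hJI hw))
  have hle : (J.biUnion fun z => insert z (commonNbrs G x z)).card ≤ k := by
    rw [← hdeg x]
    refine Finset.card_le_card fun p hp => ?_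
    simp only [Finset.mem_biUnion, Finset.mem_insert, mem_commonNbrs] at hp
    obtain ⟨z, hz, rfl | hp⟩ := hp
    · simpa using hI p (hJI hz)
    · simpa using hp.1
  rw [hJ] at h
  nlinarith

open scoped Classical in
/-- The maximal cliques `ℓ` with `lam + 2 - (s - 1) c ≤ |ℓ|`. -/
noncomputable def bigCliques (G : SimpleGraph V) (lam c s : ℕ) : Finset (Finset V) :=
  Finset.univ.filter fun ℓ => (∀ x ∈ ℓ, ∀ y ∈ ℓ, x ≠ y → G.Adj x y) ∧
    (∀ x, x ∉ ℓ → ∃ y ∈ ℓ, ¬ G.Adj x y) ∧ lam + 2 + c ≤ ℓ.card + s * c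

theorem mem_bigCliques {ℓ : Finset V} : ℓ ∈ bigCliques G lam c s ↔
    (∀ x ∈ ℓ, ∀ y ∈ ℓ, x ≠ y → G.Adj x y) ∧
    (∀ x, x ∉ ℓ → ∃ y ∈ ℓ, ¬ G.Adj x y) ∧ lam + 2 + c ≤ ℓ.card + s * c := by
  simp [bigCliques]

open scoped Classical in
theorem exists_maximal_clique_superset (C : Finset V)
    (hC : ∀ x ∈ C, ∀ y ∈ C, x ≠ y → G.Adj x y) :
    ∃ ℓ, C ⊆ ℓ ∧ (∀ x ∈ ℓ, ∀ y ∈ ℓ, x ≠ y → G.Adj x y) ∧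
      ∀ x, x ∉ ℓ → ∃ y ∈ ℓ, ¬ G.Adj x y := by
  obtain ⟨ℓ, hℓ, hmax⟩ := Finset.exists_max_image
    (Finset.univ.filter fun ℓ : Finset V => C ⊆ ℓ ∧ ∀ x ∈ ℓ, ∀ y ∈ ℓ, x ≠ y → G.Adj x y)
    Finset.card ⟨C, by simpa using hC⟩
  simp only [Finset.mem_filter, Finset.mem_univ, true_and] at hℓ hmax
  refine ⟨ℓ, hℓ.1, hℓ.2, fun x hx => ?_⟩
  by_contra! hcon
  have := hmax (insert x ℓ) ⟨hℓ.1.trans (Finset.subset_insert _ _), by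
    intro p hp q hq hpq
    rw [Finset.mem_insert] at hp hq
    rcases hp with rfl | hp <;> rcases hq with rfl | hq
    · exact absurd rfl hpq
    · exact hcon q hq
    · exact (hcon p hp).symm
    · exact hℓ.2 p hp q hq hpq⟩
  rw [Finset.card_insert_of_notMem hx] at this
  omega

open scoped Classical in
theorem bigCliques_unique
    (hlam : ∀ x y, G.Adj x y → (commonNbrs G x y).card = lam)
    (hmu : ∀ x y, x ≠ y → ¬ G.Adj x y → (commonNbrs G x y).card ≤ c + 1)
    (h2 : 2 * s * c < lam + 1 + c) :
    ∀ ℓ ∈ bigCliques G lam c s, ∀ ℓ' ∈ bigCliques G lam c s, ∀ x y, x ≠ y →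
      x ∈ ℓ → y ∈ ℓ → x ∈ ℓ' → y ∈ ℓ' → ℓ = ℓ' := by
  intro ℓ hℓ ℓ' hℓ' x y hxy hx hy hx' hy'
  rw [mem_bigCliques] at hℓ hℓ'
  obtain ⟨hcl, hmx, hsz⟩ := hℓ
  obtain ⟨hcl', hmx', hsz'⟩ := hℓ'
  by_contra hne
  have hsub : ¬ ℓ' ⊆ ℓ := by
    intro hsub
    obtain ⟨p, hp, hp'⟩ := Finset.exists_of_ssubset (hsub.ssubset_of_ne (Ne.symm hne))
    obtain ⟨q, hq, hpq⟩ := hmx' p hp'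
    exact hpq (hcl p hp q (hsub hq) (fun h => hp' (h ▸ hq)))
  obtain ⟨p, hp', hp⟩ := Finset.not_subset.1 hsub
  obtain ⟨q, hq, hpq⟩ := hmx p hp
  have hpneq : p ≠ q := fun h => hp (h ▸ hq)
  have hq' : q ∉ ℓ' := fun h => hpq (hcl' p hp' q h hpneq)
  have hint : (ℓ ∩ ℓ').card ≤ c + 1 := by
    refine (Finset.card_le_card fun r hr => ?_).trans (hmu p q hpneq hpq)
    rw [Finset.mem_inter] at hr
    rw [mem_commonNbrs]
    exact ⟨hcl' p hp' r hr.2 (fun h => hp (h ▸ hr.1)), hcl q hq r hr.1 (fun h => hq' (h ▸ hr.2))⟩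
  have hun : (ℓ ∪ ℓ').card ≤ lam + 2 := by
    have h3 : ℓ ∪ ℓ' ⊆ insert x (insert y (commonNbrs G x y)) := by
      intro r hr
      simp only [Finset.mem_insert, mem_commonNbrs]
      by_cases hrx : r = x
      · exact Or.inl hrx
      by_cases hry : r = y
      · exact Or.inr (Or.inl hry)
      rcases Finset.mem_union.1 hr with hr | hr
      · exact Or.inr (Or.inr ⟨hcl x hx r hr (Ne.symm hrx), hcl y hy r hr (Ne.symm hry)⟩)
      · exact Or.inr (Or.inr ⟨hcl' x hx' r hr (Ne.symm hrx), hcl' y hy' r hr (Ne.symm hry)⟩)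
    have h4 := Finset.card_le_card h3
    have h5 := Finset.card_insert_le x (insert y (commonNbrs G x y))
    have h6 := Finset.card_insert_le y (commonNbrs G x y)
    rw [hlam x y (hcl x hx y hy hxy)] at h6
    omega
  have := Finset.card_union_add_card_inter ℓ ℓ'
  nlinarith

open scoped Classical in
theorem card_nbrs_on_bigClique_erase_le
    (hmu : ∀ x y, x ≠ y → ¬ G.Adj x y → (commonNbrs G x y).card ≤ c + 1)
    {ℓ : Finset V} (hℓ : ℓ ∈ bigCliques G lam c s) {x q : V} (hx : x ∈ ℓ) (hxq : G.Adj x q)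
    (hq : q ∉ ℓ) : ((ℓ.erase x).filter fun p => G.Adj q p).card ≤ c := by
  rw [mem_bigCliques] at hℓ
  obtain ⟨y, hy, hqy⟩ := hℓ.2.1 q hq
  have hqney : q ≠ y := fun h => hq (h ▸ hy)
  have hxy : x ≠ y := fun h => hqy (h ▸ hxq.symm)
  refine card_le_of_subset_commonNbrs hmu hxq (hℓ.1 x hx y hy hxy) hqney hqy fun p hp => ?_
  simp only [Finset.mem_filter, Finset.mem_erase] at hp
  exact ⟨hp.1.1, hp.2, hℓ.1 y hy p hp.1.2 fun h => hqy (h ▸ hp.2)⟩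

open scoped Classical in
theorem exists_bigCliques_covering
    (hdeg : ∀ x, (Finset.univ.filter fun z => G.Adj x z).card = k)
    (hlam : ∀ x y, G.Adj x y → (commonNbrs G x y).card = lam)
    (hmu : ∀ x y, x ≠ y → ¬ G.Adj x y → (commonNbrs G x y).card ≤ c + 1)
    (h1 : 2 * k + s * (s + 1) * c < 2 * (s + 1) * (lam + 1))
    (h2 : 2 * s * c < lam + 1 + c) (x : V) :
    ∃ T : Finset (Finset V), T ⊆ bigCliques G lam c s ∧ T.card ≤ s ∧
      ∀ w, G.Adj x w → ∃ ℓ ∈ T, x ∈ ℓ ∧ w ∈ ℓ := by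
  obtain ⟨I, hI, hmax⟩ := Finset.exists_max_image
    (Finset.univ.filter fun I : Finset V => (∀ z ∈ I, G.Adj x z) ∧
      ∀ z ∈ I, ∀ w ∈ I, ¬ G.Adj z w) Finset.card ⟨∅, by simp⟩
  simp only [Finset.mem_filter, Finset.mem_univ, true_and] at hI hmax
  obtain ⟨hIx, hIco⟩ := hI
  have hIs := coclique_card_le hdeg hlam hmu h1 x I hIx hIco
  have hline : ∀ z ∈ I, ∃ ℓ ∈ bigCliques G lam c s, x ∈ ℓ ∧ z ∈ ℓ := by
    intro z hz
    have hxz := hIx z hz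
    set B := (commonNbrs G x z).filter fun p => ∃ w ∈ I.erase z, G.Adj w p with hB
    have hBcard : B.card ≤ (I.card - 1) * c := by
      have : B ⊆ (I.erase z).biUnion fun w => (commonNbrs G x z).filter fun p => G.Adj w p := by
        intro p hp
        simp only [hB, Finset.mem_filter] at hp
        obtain ⟨hp1, w, hw, hp2⟩ := hp
        exact Finset.mem_biUnion.2 ⟨w, hw, Finset.mem_filter.2 ⟨hp1, hp2⟩⟩
      refine (Finset.card_le_card this).trans ?_
      rw [← Finset.card_erase_of_mem hz]
      refine Finset.card_biUnion_le_card_mul _ _ _ fun w hw => ?_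
      rw [Finset.mem_erase] at hw
      refine card_le_of_subset_commonNbrs hmu hxz (hIx w hw.2) (Ne.symm hw.1)
        (hIco z hz w hw.2) fun p hp => ?_
      simp only [Finset.mem_filter, mem_commonNbrs] at hp
      exact ⟨hp.1.1.ne', hp.1.2, hp.2⟩
    set C := (commonNbrs G x z) \ B with hC
    have hmemC : ∀ p ∈ C, G.Adj x p ∧ G.Adj z p ∧ ∀ w ∈ I, w ≠ z → ¬ G.Adj w p := by
      intro p hp
      simp only [hC, hB, Finset.mem_sdiff, Finset.mem_filter, mem_commonNbrs, Finset.mem_erase,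
        not_and, not_exists] at hp
      exact ⟨hp.1.1, hp.1.2, fun w hw hwz => hp.2 hp.1 w ⟨hwz, hw⟩⟩
    have hCcl : ∀ p ∈ C, ∀ q ∈ C, p ≠ q → G.Adj p q := by
      intro p hp q hq hpq
      by_contra hcon
      obtain ⟨hp1, hp2, hp3⟩ := hmemC p hp
      obtain ⟨hq1, hq2, hq3⟩ := hmemC q hq
      have hpI : p ∉ I := fun h => hIco z hz p h hp2
      have hqI : q ∉ I := fun h => hIco z hz q h hq2
      have hle := hmax (insert p (insert q (I.erase z))) ⟨by
          intro w hw
          simp only [Finset.mem_insert, Finset.mem_erase] at hw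
          rcases hw with rfl | rfl | hw
          · exact hp1
          · exact hq1
          · exact hIx w hw.2, by
          intro w hw v hv
          simp only [Finset.mem_insert, Finset.mem_erase] at hw hv
          rcases hw with rfl | rfl | hw <;> rcases hv with rfl | rfl | hv
          · exact G.irrefl
          · exact hcon
          · exact fun h => hp3 v hv.2 hv.1 h.symm
          · exact fun h => hcon h.symm
          · exact G.irrefl
          · exact fun h => hq3 v hv.2 hv.1 h.symm
          · exact hp3 w hw.2 hw.1
          · exact hq3 w hw.2 hw.1
          · exact hIco w hw.2 v hv.2⟩
      rw [Finset.card_insert_of_notMem, Finset.card_insert_of_notMem,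
        Finset.card_erase_of_mem hz] at hle
      · have : 0 < I.card := Finset.card_pos.2 ⟨z, hz⟩
        omega
      · simp [hqI]
      · simp [hpI, hpq]
    obtain ⟨ℓ, hsub, hcl, hmx⟩ := exists_maximal_clique_superset (G := G) (insert x (insert z C)) (by
      intro p hp q hq hpq
      simp only [Finset.mem_insert] at hp hq
      rcases hp with rfl | rfl | hp <;> rcases hq with rfl | rfl | hq
      · exact absurd rfl hpq
      · exact hxz
      · exact (hmemC q hq).1
      · exact hxz.symm
      · exact absurd rfl hpq
      · exact (hmemC q hq).2.1
      · exact (hmemC p hp).1.symm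
      · exact (hmemC p hp).2.1.symm
      · exact hCcl p hp q hq hpq)
    refine ⟨ℓ, mem_bigCliques.2 ⟨hcl, hmx, ?_⟩, hsub (by simp), hsub (by simp)⟩
    have hle := Finset.card_le_card hsub
    rw [Finset.card_insert_of_notMem, Finset.card_insert_of_notMem] at hle
    · have hsd := Finset.card_sdiff_add_card_eq_card
        (show B ⊆ commonNbrs G x z from Finset.filter_subset _ _)
      rw [hlam x z hxz] at hsd
      have hpos : 0 < I.card := Finset.card_pos.2 ⟨z, hz⟩
      obtain ⟨j, hj⟩ : ∃ j, I.card = j + 1 := ⟨I.card - 1, by omega⟩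
      rw [hj] at hBcard hIs
      simp only [Nat.add_sub_cancel] at hBcard
      have : (j + 1) * c ≤ s * c := Nat.mul_le_mul_right c hIs
      rw [← hC] at hsd
      nlinarith
    · intro h
      exact G.irrefl (hmemC z h).2.1
    · intro h
      rw [Finset.mem_insert] at h
      rcases h with h | h
      · exact hxz.ne h
      · exact G.irrefl (hmemC x h).1
  choose! f hfL hfx hfz using hline
  refine ⟨I.image f, ?_, Finset.card_image_le.trans hIs, ?_⟩
  · intro ℓ hℓ
    obtain ⟨z, hz, rfl⟩ := Finset.mem_image.1 hℓ
    exact hfL z hz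
  intro w hxw
  by_contra hcon
  have hwf : ∀ z ∈ I, w ∉ f z := fun z hz h =>
    hcon ⟨f z, Finset.mem_image_of_mem f hz, hfx z hz, h⟩
  have hgreedy : ∀ J : Finset V, J ⊆ I → ∃ K : Finset V, K.card = J.card + 1 ∧
      (∀ q ∈ K, G.Adj x q) ∧ (∀ q ∈ K, ∀ p ∈ K, ¬ G.Adj q p) ∧
      ∀ q ∈ K, q = w ∨ ∃ z ∈ J, q ∈ f z := by
    intro J
    induction J using Finset.induction_on with
    | empty =>
      intro _
      exact ⟨{w}, by simp, by simpa using hxw, by simp, by simp⟩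
    | insert z J hz ih =>
      intro hJ
      have hzI := hJ (Finset.mem_insert_self _ _)
      have hJI : J ⊆ I := (Finset.subset_insert _ _).trans hJ
      obtain ⟨K, hK, hKx, hKco, hKf⟩ := ih hJI
      have hKz : ∀ q ∈ K, q ∉ f z := by
        intro q hq hqz
        rcases hKf q hq with rfl | ⟨z', hz', hqz'⟩
        · exact hwf z hzI hqz
        · have hff := bigCliques_unique hlam hmu h2 _ (hfL z hzI) _ (hfL z' (hJI hz')) x q
            (hKx q hq).ne (hfx z hzI) hqz (hfx z' (hJI hz')) hqz'
          have hne : z ≠ z' := fun h => hz (h ▸ hz')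
          exact hIco z hzI z' (hJI hz') ((mem_bigCliques.1 (hfL z hzI)).1 z (hfz z hzI) z'
            (hff ▸ hfz z' (hJI hz')) hne)
      have hbad : (K.biUnion fun q => ((f z).erase x).filter fun p => G.Adj q p).card
          ≤ K.card * c :=
        Finset.card_biUnion_le_card_mul _ _ _ fun q hq =>
          card_nbrs_on_bigClique_erase_le hmu (hfL z hzI) (hfx z hzI) (hKx q hq) (hKz q hq)
      have hKs : K.card ≤ s := by
        have := Finset.card_le_card hJ
        rw [Finset.card_insert_of_notMem hz] at this
        omega
      have hlt : (K.biUnion fun q => ((f z).erase x).filter fun p => G.Adj q p).card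
          < ((f z).erase x).card := by
        have h3 := (mem_bigCliques.1 (hfL z hzI)).2.2
        rw [Finset.card_erase_of_mem (hfx z hzI)]
        have : K.card * c ≤ s * c := Nat.mul_le_mul_right c hKs
        have h4 : 2 * (s * c) < lam + 1 + c := by linarith
        omega
      obtain ⟨p, hp, hpn⟩ := Finset.exists_mem_notMem_of_card_lt_card hlt
      have hpK : ∀ q ∈ K, ¬ G.Adj q p := fun q hq h =>
        hpn (Finset.mem_biUnion.2 ⟨q, hq, Finset.mem_filter.2 ⟨hp, h⟩⟩)
      rw [Finset.mem_erase] at hp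
      have hpnK : p ∉ K := fun h => hKz p h hp.2
      refine ⟨insert p K, ?_, ?_, ?_, ?_⟩
      · rw [Finset.card_insert_of_notMem hpnK, Finset.card_insert_of_notMem hz, hK]
      · intro q hq
        rw [Finset.mem_insert] at hq
        rcases hq with rfl | hq
        · exact (mem_bigCliques.1 (hfL z hzI)).1 x (hfx z hzI) q hp.2 (Ne.symm hp.1)
        · exact hKx q hq
      · intro q hq v hv
        rw [Finset.mem_insert] at hq hv
        rcases hq with rfl | hq <;> rcases hv with rfl | hv
        · exact G.irrefl
        · exact fun h => hpK v hv h.symm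
        · exact hpK q hq
        · exact hKco q hq v hv
      · intro q hq
        rw [Finset.mem_insert] at hq
        rcases hq with rfl | hq
        · exact Or.inr ⟨z, Finset.mem_insert_self _ _, hp.2⟩
        · rcases hKf q hq with h | ⟨z', hz', h⟩
          · exact Or.inl h
          · exact Or.inr ⟨z', Finset.mem_insert_of_mem hz', h⟩
  obtain ⟨K, hK, hKx, hKco, -⟩ := hgreedy I subset_rfl
  have := hmax K ⟨hKx, hKco⟩
  omega

open scoped Classical in
/-- A Bose–Laskar type theorem: under the stated inequalities the big maximal cliques form a line
system with at most `s` lines through each vertex. -/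
theorem bigCliques_isLineSystem
    (hdeg : ∀ x, (Finset.univ.filter fun z => G.Adj x z).card = k)
    (hlam : ∀ x y, G.Adj x y → (commonNbrs G x y).card = lam)
    (hmu : ∀ x y, x ≠ y → ¬ G.Adj x y → (commonNbrs G x y).card ≤ c + 1)
    (h1 : 2 * k + s * (s + 1) * c < 2 * (s + 1) * (lam + 1))
    (h2 : 2 * s * c < lam + 1 + c) :
    IsLineSystem G (bigCliques G lam c s) ∧
      ∀ x, ((bigCliques G lam c s).filter fun ℓ => x ∈ ℓ).card ≤ s := by
  have huniq := bigCliques_unique hlam hmu h2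
  refine ⟨⟨fun ℓ hℓ => (mem_bigCliques.1 hℓ).1, ?_, huniq,
    fun ℓ hℓ => (mem_bigCliques.1 hℓ).2.1⟩, ?_⟩
  · intro x y hxy
    obtain ⟨T, hT, -, hcov⟩ := exists_bigCliques_covering hdeg hlam hmu h1 h2 x
    obtain ⟨ℓ, hℓ, h⟩ := hcov y hxy
    exact ⟨ℓ, hT hℓ, h⟩
  · intro x
    obtain ⟨T, hT, hTs, hcov⟩ := exists_bigCliques_covering hdeg hlam hmu h1 h2 x
    refine (Finset.card_le_card fun ℓ hℓ => ?_).trans hTs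
    rw [Finset.mem_filter] at hℓ
    have h3 := mem_bigCliques.1 hℓ.1
    have h4 : 1 < ℓ.card := by
      have h5 : 2 * (s * c) < lam + 1 + c := by linarith
      have h6 := h3.2.2
      omega
    obtain ⟨w, hw, hwx⟩ := Finset.exists_mem_ne h4 x
    have hxw := h3.1 x hℓ.2 w hw (Ne.symm hwx)
    obtain ⟨ℓ', hℓ', hx', hw'⟩ := hcov w hxw
    rw [huniq ℓ hℓ.1 ℓ' (hT hℓ') x w hxw.ne hℓ.2 hw hx' hw']
    exact hℓ'

end LineSystems

section Eigenspace

theorem gauss_zero (b : ℕ) : gauss b 0 = 0 := by simp [gauss]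

theorem gauss_one (b : ℕ) : gauss b 1 = 1 := by simp [gauss]

theorem gauss_succ (b j : ℕ) : gauss b (j + 1) = 1 + b * gauss b j := by
  rw [gauss, gauss, Finset.sum_range_succ', Finset.mul_sum]
  simp only [pow_succ', pow_zero]
  ring

theorem gauss_two (b : ℕ) : gauss b 2 = b + 1 := by
  rw [gauss_succ, gauss_one]; ring

theorem gauss_three (b : ℕ) : gauss b 3 = b ^ 2 + b + 1 := by
  rw [gauss_succ, gauss_two]; ring

theorem gauss_mono (b : ℕ) {i j : ℕ} (h : i ≤ j) : gauss b i ≤ gauss b j := by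
  refine Finset.sum_le_sum_of_subset_of_nonneg (Finset.range_mono h) fun _ _ _ => by positivity

theorem gauss_nonneg (b j : ℕ) : 0 ≤ gauss b j :=
  Finset.sum_nonneg fun _ _ => by positivity

theorem one_le_gauss_succ (b j : ℕ) : 1 ≤ gauss b (j + 1) := by
  have := gauss_mono b (Nat.le_add_left 1 j)
  rwa [gauss_one] at this

variable [Fintype V]

open scoped Classical in
/-- The intersection numbers of a graph with classical parameters `(D, b, α, β)`, together with
the consequences `b ≥ 2`, `D ≥ 3`, `α ≥ 0` and the lower bounds on `β`. -/
structure LargeBeta (G : SimpleGraph V) (D b : ℕ) (α β : ℝ) : Prop where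
  connected : G.Connected
  dist_le : ∀ x y, G.dist x y ≤ D
  card_next : ∀ x y, ((Finset.univ.filter fun z => G.Adj y z ∧ G.dist x z = G.dist x y + 1).card : ℝ)
    = (gauss b D - gauss b (G.dist x y)) * (β - α * gauss b (G.dist x y))
  card_prev : ∀ x y, ((Finset.univ.filter fun z => G.Adj y z ∧ G.dist x z + 1 = G.dist x y).card : ℝ)
    = gauss b (G.dist x y) * (1 + α * gauss b (G.dist x y - 1))
  two_le : 2 ≤ b
  three_le : 3 ≤ D
  alpha_nonneg : 0 ≤ α
  alpha_eq_or : α = 0 ∨ 1 ≤ α * (b + 1)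
  le_beta : (2 * (b : ℝ) + 4) / (2 * b + 3) * gauss b D * (b + 2) * (α * b + b + α) ≤ β
  le_beta' : (2 * (b : ℝ) + 4) / (2 * b + 3) * gauss b D * ((b + 1) * (b ^ 2 + b + 2) - 3) ≤ β

variable {G : SimpleGraph V} {D b : ℕ} {α β : ℝ}

namespace LargeBeta

theorem seven_le_gauss (h : LargeBeta G D b α β) : 7 ≤ gauss b D := by
  have h1 := gauss_mono b h.three_le
  have h2 : (2 : ℝ) ≤ b := by exact_mod_cast h.two_le
  rw [gauss_three] at h1
  nlinarith

theorem gauss_mul_le_beta (h : LargeBeta G D b α β) : gauss b D * (12 * α + 8) ≤ β := by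
  have h1 := h.seven_le_gauss
  have h2 : (2 : ℝ) ≤ b := by exact_mod_cast h.two_le
  have h3 := h.alpha_nonneg
  refine le_trans ?_ h.le_beta
  have h4 : 1 ≤ (2 * (b : ℝ) + 4) / (2 * b + 3) := by
    rw [le_div_iff₀ (by positivity)]; linarith
  have h5 : 12 * α + 8 ≤ (b + 2) * (α * b + b + α) := by
    have : 3 * α + 2 ≤ α * b + b + α := by nlinarith
    nlinarith
  have h6 : gauss b D ≤ (2 * (b : ℝ) + 4) / (2 * b + 3) * gauss b D := by nlinarith
  calc gauss b D * (12 * α + 8) ≤ ((2 * (b : ℝ) + 4) / (2 * b + 3) * gauss b D) *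
        ((b + 2) * (α * b + b + α)) := by
        apply mul_le_mul h6 h5 (by positivity) (by linarith)
    _ = _ := by ring

theorem beta_pos (h : LargeBeta G D b α β) : 0 < β := by
  have := h.gauss_mul_le_beta
  have := h.seven_le_gauss
  have := h.alpha_nonneg
  nlinarith

/-- The quantities `β - α [i]` are large. -/
theorem le_beta_sub (h : LargeBeta G D b α β) {i : ℕ} (hi : i ≤ D) :
    2 * (gauss b D * (1 + α)) ≤ β - α * gauss b i := by
  have := h.gauss_mul_le_beta
  have h1 := h.seven_le_gauss
  have h2 := gauss_mono b hi
  have := mul_le_mul_of_nonneg_left h2 h.alpha_nonneg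
  nlinarith [mul_nonneg h.alpha_nonneg (by linarith : 0 ≤ gauss b D)]

theorem beta_sub_pos (h : LargeBeta G D b α β) {i : ℕ} (hi : i ≤ D) :
    0 < β - α * gauss b i := by
  have := h.le_beta_sub hi
  have h1 := h.seven_le_gauss
  have h2 := h.alpha_nonneg
  nlinarith

theorem dist_le_succ (h : LargeBeta G D b α β) {x y z : V} (hyz : G.Adj y z) :
    G.dist x z ≤ G.dist x y + 1 := by
  have := h.connected.dist_triangle (u := x) (v := y) (w := z)
  rwa [dist_eq_one_iff_adj.2 hyz] at this

open scoped Classical in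
theorem card_adj (h : LargeBeta G D b α β) (y : V) :
    ((Finset.univ.filter fun z => G.Adj y z).card : ℝ) = gauss b D * β := by
  have := h.card_next y y
  simp only [dist_self, gauss_zero, mul_zero, sub_zero, zero_add] at this
  rw [← this]
  congr 2
  ext z
  simp only [Finset.mem_filter, Finset.mem_univ, true_and, dist_eq_one_iff_adj, and_self]

open scoped Classical in
/-- Sum over the neighbours of `y` of a function of the distance to `x`. -/
theorem sum_adj_dist (h : LargeBeta G D b α β) (x y : V) (f : ℕ → ℝ) :
    ∑ z ∈ Finset.univ.filter (fun z => G.Adj y z), f (G.dist x z) =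
      gauss b (G.dist x y) * (1 + α * gauss b (G.dist x y - 1)) * f (G.dist x y - 1) +
      (gauss b D * β - (gauss b D - gauss b (G.dist x y)) * (β - α * gauss b (G.dist x y))
        - gauss b (G.dist x y) * (1 + α * gauss b (G.dist x y - 1))) * f (G.dist x y) +
      (gauss b D - gauss b (G.dist x y)) * (β - α * gauss b (G.dist x y))
        * f (G.dist x y + 1) := by
  set i := G.dist x y with hi
  have h1 : ∀ z ∈ Finset.univ.filter (fun z => G.Adj y z), f (G.dist x z) =
      f i + (if G.dist x z + 1 = i then f (i - 1) - f i else 0) +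
        (if G.dist x z = i + 1 then f (i + 1) - f i else 0) := by
    intro z hz
    rw [Finset.mem_filter] at hz
    have h2 := h.dist_le_succ (x := x) hz.2
    have h3 := h.dist_le_succ (x := x) hz.2.symm
    rcases (by omega : G.dist x z + 1 = i ∨ G.dist x z = i ∨ G.dist x z = i + 1) with h4 | h4 | h4
    · rw [if_pos h4, if_neg (by omega), show G.dist x z = i - 1 by omega]; ring
    · rw [if_neg (by omega), if_neg (by omega), h4]; ring
    · rw [if_neg (by omega), if_pos h4, h4]; ring
  rw [Finset.sum_congr rfl h1, Finset.sum_add_distrib, Finset.sum_add_distrib, Finset.sum_const,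
    ← Finset.sum_filter, ← Finset.sum_filter, Finset.sum_const, Finset.sum_const,
    Finset.filter_filter, Finset.filter_filter, nsmul_eq_mul, nsmul_eq_mul, nsmul_eq_mul,
    h.card_adj, h.card_prev x y, h.card_next x y, ← hi]
  ring

end LargeBeta

/-- The standard sequence of the eigenvalue `-[D]`. -/
noncomputable def stdSeq (b : ℕ) (α β : ℝ) : ℕ → ℝ
  | 0 => 1
  | i + 1 => -(stdSeq b α β i * (1 + α * gauss b i) / (β - α * gauss b i))

theorem stdSeq_one (b : ℕ) (α β : ℝ) : stdSeq b α β 1 = -1 / β := by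
  simp [stdSeq, gauss_zero, neg_div]

/-- The ratios of the spherical sums of a `-[D]`-eigenfunction to its value in the centre. -/
noncomputable def sphereSeq (b D : ℕ) : ℕ → ℝ
  | 0 => 1
  | i + 1 => -((gauss b D - gauss b i) / gauss b (i + 1) * sphereSeq b D i)

open scoped Classical in
/-- Eigenfunctions of the adjacency operator for the eigenvalue `-θ`. -/
def IsNegEigenfunction (G : SimpleGraph V) (θ : ℝ) (g : V → ℝ) : Prop :=
  ∀ y, ∑ z ∈ Finset.univ.filter (fun z => G.Adj y z), g z = -θ * g y

/-- The scalar by which the matrix of the standard sequence acts on the eigenspace. -/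
noncomputable def idemScalar (D b : ℕ) (α β : ℝ) : ℝ :=
  ∑ i ∈ Finset.range (D + 1), stdSeq b α β i * sphereSeq b D i

namespace LargeBeta

theorem stdSeq_rec (h : LargeBeta G D b α β) {i : ℕ} (hi : i ≤ D) :
    gauss b i * (1 + α * gauss b (i - 1)) * stdSeq b α β (i - 1) +
      (gauss b D * β - (gauss b D - gauss b i) * (β - α * gauss b i)
        - gauss b i * (1 + α * gauss b (i - 1))) * stdSeq b α β i +
      (gauss b D - gauss b i) * (β - α * gauss b i) * stdSeq b α β (i + 1) =
    -gauss b D * stdSeq b α β i := by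
  have h1 : (β - α * gauss b i) * stdSeq b α β (i + 1) =
      -(stdSeq b α β i * (1 + α * gauss b i)) := by
    rw [stdSeq]; field_simp [(h.beta_sub_pos hi).ne']
  have h2 : gauss b i * (1 + α * gauss b (i - 1)) * stdSeq b α β (i - 1) =
      -(gauss b i * (β - α * gauss b (i - 1)) * stdSeq b α β i) := by
    cases i with
    | zero => simp [gauss_zero]
    | succ j =>
      have : j ≤ D := by omega
      rw [Nat.add_sub_cancel]
      rw [stdSeq]; field_simp [(h.beta_sub_pos this).ne']
  rw [h2, mul_assoc (gauss b D - gauss b i) _ (stdSeq b α β (i + 1)), h1]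
  ring

theorem isNegEigenfunction_stdSeq (h : LargeBeta G D b α β) (x : V) :
    IsNegEigenfunction G (gauss b D) fun y => stdSeq b α β (G.dist x y) := by
  intro y
  rw [h.sum_adj_dist, h.stdSeq_rec (h.dist_le x y)]

open scoped Classical in
theorem sum_sphere (h : LargeBeta G D b α β) {g : V → ℝ}
    (hg : IsNegEigenfunction G (gauss b D) g) (x : V) (i : ℕ) (hi : i ≤ D) :
    gauss b (i + 1) * ∑ z ∈ Finset.univ.filter (fun z => G.dist x z = i + 1), g z =
      -((gauss b D - gauss b i) * ∑ z ∈ Finset.univ.filter (fun z => G.dist x z = i), g z) := by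
  have key : ∀ i ≤ D, (if i = 0 then 0 else (gauss b D - gauss b (i - 1)) *
        (β - α * gauss b (i - 1)) * ∑ z ∈ Finset.univ.filter (fun z => G.dist x z = i - 1), g z)
      + (gauss b D * β - (gauss b D - gauss b i) * (β - α * gauss b i)
        - gauss b i * (1 + α * gauss b (i - 1))) *
          ∑ z ∈ Finset.univ.filter (fun z => G.dist x z = i), g z
      + gauss b (i + 1) * (1 + α * gauss b i) *
          ∑ z ∈ Finset.univ.filter (fun z => G.dist x z = i + 1), g z
      = -gauss b D * ∑ z ∈ Finset.univ.filter (fun z => G.dist x z = i), g z := by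
    intro i hi
    have h1 : ∑ y ∈ Finset.univ.filter (fun z => G.dist x z = i),
        ∑ z ∈ Finset.univ.filter (fun z => G.Adj y z), g z =
        ∑ z, g z * ∑ y ∈ Finset.univ.filter (fun y => G.Adj z y),
          if G.dist x y = i then (1 : ℝ) else 0 := by
      simp only [Finset.sum_filter, Finset.mul_sum]
      rw [Finset.sum_comm]
      · have : ∀ y, (if G.dist x y = i then ∑ z, if G.Adj y z then g z else 0 else 0) =
            ∑ z, g z * if G.Adj z y then (if G.dist x y = i then (1 : ℝ) else 0) else 0 := by
          intro y
          split_ifs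
          · refine Finset.sum_congr rfl fun z _ => ?_
            rw [G.adj_comm]; split_ifs <;> simp
          · simp
        exact Finset.sum_congr rfl fun y _ => this y
    have h2 : ∀ z, g z * ∑ y ∈ Finset.univ.filter (fun y => G.Adj z y),
          (if G.dist x y = i then (1 : ℝ) else 0) =
        (if i = 0 then 0 else (gauss b D - gauss b (i - 1)) *
          (β - α * gauss b (i - 1)) * if G.dist x z = i - 1 then g z else 0)
        + (gauss b D * β - (gauss b D - gauss b i) * (β - α * gauss b i)
          - gauss b i * (1 + α * gauss b (i - 1))) * (if G.dist x z = i then g z else 0)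
        + gauss b (i + 1) * (1 + α * gauss b i) * (if G.dist x z = i + 1 then g z else 0) := by
      intro z
      rw [h.sum_adj_dist x z (fun j => if j = i then (1 : ℝ) else 0)]
      set j := G.dist x z with hj
      by_cases h3 : j = i + 1
      · have h4 : ¬ (i + 1 = i - 1) := by omega
        have h5 : ¬ (i + 1 + 1 = i) := by omega
        simp [h3, h4, h5]; ring
      by_cases h4 : j = i
      · rw [h4]
        by_cases h0 : i = 0
        · subst h0; simp [gauss_zero]
        · have : i - 1 ≠ i := by omega
          have : i ≠ i - 1 := by omega
          simp [*]; ring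
      by_cases h5 : i = j + 1
      · have h6 : ¬ (j - 1 = j + 1) := by omega
        have h7 : ¬ (j = j + 1 + 1) := by omega
        simp [h5, h6, h7]; ring
      · have h6 : j ≠ i - 1 ∨ i = 0 := by omega
        have h7 : ¬ (j + 1 = i) := by omega
        by_cases h8 : j - 1 = i
        · have h9 : j = 0 := by omega
          omega
        · rcases h6 with h6 | h6
          · simp only [if_neg h8, if_neg h4, if_neg h7, if_neg h3, if_neg h6]
            simp
          · simp only [if_neg h8, if_neg h4, if_neg h7, if_neg h3, if_pos h6]
            simp
    have h3 : ∑ y ∈ Finset.univ.filter (fun z => G.dist x z = i),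
        ∑ z ∈ Finset.univ.filter (fun z => G.Adj y z), g z =
        -gauss b D * ∑ z ∈ Finset.univ.filter (fun z => G.dist x z = i), g z := by
      rw [Finset.mul_sum]
      exact Finset.sum_congr rfl fun y _ => hg y
    rw [← h3, h1, Finset.sum_congr rfl fun z _ => h2 z, Finset.sum_add_distrib,
      Finset.sum_add_distrib, ← Finset.mul_sum, ← Finset.mul_sum, ← Finset.sum_filter,
      ← Finset.sum_filter]
    congr 2
    split_ifs
    · simp
    · rw [← Finset.mul_sum, ← Finset.sum_filter]
  have hpos : ∀ i, 1 + α * gauss b i ≠ 0 := fun i => by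
    have := mul_nonneg h.alpha_nonneg (gauss_nonneg b i)
    positivity
  induction i with
  | zero =>
    have h0 := key 0 hi
    refine mul_left_cancel₀ (hpos 0) ?_
    simp only [gauss_zero, if_true] at h0 ⊢
    linear_combination h0
  | succ i ih =>
    have h0 := key (i + 1) hi
    have h1 := ih (by omega)
    refine mul_left_cancel₀ (hpos (i + 1)) ?_
    simp only [Nat.add_sub_cancel, Nat.add_eq_zero_iff, one_ne_zero, and_false, if_false] at h0
    linear_combination h0 - (β - α * gauss b i) * h1

open scoped Classical in
theorem sum_sphere_eq (h : LargeBeta G D b α β) {g : V → ℝ}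
    (hg : IsNegEigenfunction G (gauss b D) g) (x : V) (i : ℕ) (hi : i ≤ D) :
    ∑ z ∈ Finset.univ.filter (fun z => G.dist x z = i), g z = sphereSeq b D i * g x := by
  induction i with
  | zero =>
    have : (Finset.univ.filter fun z => G.dist x z = 0) = {x} := by
      ext z
      simp [h.connected.dist_eq_zero_iff, eq_comm]
    rw [this]; simp [sphereSeq]
  | succ i ih =>
    have h1 := h.sum_sphere hg x i (by omega)
    rw [ih (by omega)] at h1
    have h2 := one_le_gauss_succ b i
    have h3 : gauss b (i + 1) ≠ 0 := by positivity
    refine mul_left_cancel₀ h3 ?_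
    rw [h1, sphereSeq]
    field_simp

/-- The matrix of the standard sequence acts as a scalar on the eigenspace of `-[D]`. -/
theorem sum_stdSeq_mul (h : LargeBeta G D b α β) {g : V → ℝ}
    (hg : IsNegEigenfunction G (gauss b D) g) (x : V) :
    ∑ y, stdSeq b α β (G.dist x y) * g y = idemScalar D b α β * g x := by
  classical
  rw [idemScalar, Finset.sum_mul, ← Finset.sum_fiberwise_of_maps_to
    (s := Finset.univ) (t := Finset.range (D + 1)) (g := fun y => G.dist x y)
    (fun y _ => Finset.mem_range.2 (Nat.lt_succ_of_le (h.dist_le x y)))]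
  refine Finset.sum_congr rfl fun i hi => ?_
  rw [Finset.mem_range] at hi
  rw [mul_assoc, ← h.sum_sphere_eq hg x i (by omega), Finset.mul_sum]
  refine Finset.sum_congr rfl fun y hy => ?_
  rw [Finset.mem_filter] at hy
  rw [hy.2]

theorem idemScalar_term (h : LargeBeta G D b α β) {i : ℕ} (hi : i ≤ D) :
    0 ≤ stdSeq b α β i * sphereSeq b D i ∧
      stdSeq b α β i * sphereSeq b D i ≤ (1 / 2) ^ i := by
  induction i with
  | zero => simp [stdSeq, sphereSeq]
  | succ i ih =>
    obtain ⟨h1, h2⟩ := ih (by omega)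
    have h3 := h.beta_sub_pos (show i ≤ D by omega)
    have h4 := h.le_beta_sub (show i ≤ D by omega)
    have h5 := one_le_gauss_succ b i
    have h6 := gauss_mono b (show i ≤ D by omega)
    have h7 := gauss_nonneg b i
    have h8 := h.alpha_nonneg
    have h9 : stdSeq b α β (i + 1) * sphereSeq b D (i + 1) = stdSeq b α β i * sphereSeq b D i *
        ((1 + α * gauss b i) * (gauss b D - gauss b i) /
          ((β - α * gauss b i) * gauss b (i + 1))) := by
      rw [stdSeq, sphereSeq]
      field_simp
    have h10 : 0 ≤ (1 + α * gauss b i) * (gauss b D - gauss b i) /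
          ((β - α * gauss b i) * gauss b (i + 1)) := by
      have : 0 ≤ gauss b D - gauss b i := by linarith
      positivity
    have h11 : (1 + α * gauss b i) * (gauss b D - gauss b i) /
          ((β - α * gauss b i) * gauss b (i + 1)) ≤ 1 / 2 := by
      rw [div_le_div_iff₀ (by positivity) (by norm_num)]
      have h12 : 1 + α * gauss b i ≤ (1 + α) * gauss b (i + 1) := by
        have : gauss b i ≤ gauss b (i + 1) := gauss_mono b (by omega)
        nlinarith
      calc (1 + α * gauss b i) * (gauss b D - gauss b i) * 2
          ≤ ((1 + α) * gauss b (i + 1)) * gauss b D * 2 := by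
            gcongr
            linarith
        _ = (2 * (gauss b D * (1 + α))) * gauss b (i + 1) := by ring
        _ ≤ 1 * ((β - α * gauss b i) * gauss b (i + 1)) := by rw [one_mul]; gcongr
    rw [h9]
    refine ⟨mul_nonneg h1 h10, ?_⟩
    rw [pow_succ]
    exact mul_le_mul h2 h11 h10 (by positivity)

theorem one_le_idemScalar (h : LargeBeta G D b α β) : 1 ≤ idemScalar D b α β := by
  have h1 := Finset.single_le_sum (f := fun i => stdSeq b α β i * sphereSeq b D i)
    (s := Finset.range (D + 1))
    (fun i hi => (h.idemScalar_term (by rw [Finset.mem_range] at hi; omega)).1)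
    (Finset.mem_range.2 (Nat.succ_pos D))
  simpa [stdSeq, sphereSeq, idemScalar] using h1

theorem idemScalar_le_two (h : LargeBeta G D b α β) : idemScalar D b α β ≤ 2 := by
  calc idemScalar D b α β ≤ ∑ i ∈ Finset.range (D + 1), (1 / 2 : ℝ) ^ i :=
        Finset.sum_le_sum fun i hi =>
          (h.idemScalar_term (by rw [Finset.mem_range] at hi; omega)).2
    _ ≤ 2 := by
        rw [geom_sum_eq (by norm_num)]
        have : (0 : ℝ) ≤ (1 / 2) ^ (D + 1) := by positivity
        rw [div_le_iff_of_neg (by norm_num)]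
        linarith

/-- The quadratic form of the matrix of the standard sequence is a multiple of a square norm. -/
theorem quadForm_eq (h : LargeBeta G D b α β) (v : V → ℝ) :
    idemScalar D b α β * ∑ x, v x * ∑ y, stdSeq b α β (G.dist x y) * v y =
      ∑ x, (∑ y, stdSeq b α β (G.dist x y) * v y) ^ 2 := by
  have h1 : ∀ y z, ∑ x, stdSeq b α β (G.dist x y) * stdSeq b α β (G.dist x z) =
      idemScalar D b α β * stdSeq b α β (G.dist y z) := by
    intro y z
    have := h.sum_stdSeq_mul (h.isNegEigenfunction_stdSeq z) y
    rw [G.dist_comm (u := y) (v := z), ← this]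
    refine Finset.sum_congr rfl fun x _ => ?_
    rw [G.dist_comm (u := x) (v := y), G.dist_comm (u := x) (v := z)]
  calc _ = ∑ y, ∑ z, v y * v z * (idemScalar D b α β * stdSeq b α β (G.dist y z)) := by
        simp only [Finset.mul_sum]
        refine Finset.sum_congr rfl fun x _ => Finset.sum_congr rfl fun y _ => by ring
    _ = ∑ y, ∑ z, ∑ x, v y * v z * (stdSeq b α β (G.dist x y) * stdSeq b α β (G.dist x z)) := by
        refine Finset.sum_congr rfl fun y _ => Finset.sum_congr rfl fun z _ => ?_
        rw [← h1, Finset.mul_sum]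
    _ = ∑ y, ∑ x, ∑ z, v y * v z * (stdSeq b α β (G.dist x y) * stdSeq b α β (G.dist x z)) :=
        Finset.sum_congr rfl fun y _ => Finset.sum_comm
    _ = ∑ x, ∑ y, ∑ z, v y * v z * (stdSeq b α β (G.dist x y) * stdSeq b α β (G.dist x z)) :=
        Finset.sum_comm
    _ = _ := by
        refine Finset.sum_congr rfl fun x _ => ?_
        rw [sq, Finset.sum_mul_sum]
        refine Finset.sum_congr rfl fun y _ => Finset.sum_congr rfl fun z _ => by ring

/-- The quadratic form evaluated at a clique. -/
theorem quadForm_clique (h : LargeBeta G D b α β) {C : Finset V}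
    (hC : ∀ x ∈ C, ∀ y ∈ C, x ≠ y → G.Adj x y) :
    idemScalar D b α β * ((C.card : ℝ) * (1 - ((C.card : ℝ) - 1) / β)) =
      ∑ x, (∑ y ∈ C, stdSeq b α β (G.dist x y)) ^ 2 := by
  classical
  have h1 := h.quadForm_eq (fun x => if x ∈ C then 1 else 0)
  simp only [mul_ite, mul_one, mul_zero, ite_mul, one_mul, zero_mul, Finset.sum_ite_mem,
    Finset.univ_inter] at h1
  rw [← h1]
  congr 1
  have h2 : ∀ x ∈ C, ∑ y ∈ C, stdSeq b α β (G.dist x y) = 1 - ((C.card : ℝ) - 1) / β := by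
    intro x hx
    rw [← Finset.add_sum_erase C _ hx]
    have h3 : ∀ y ∈ C.erase x, stdSeq b α β (G.dist x y) = -1 / β := by
      intro y hy
      rw [Finset.mem_erase] at hy
      rw [dist_eq_one_iff_adj.2 (hC x hx y hy.2 (Ne.symm hy.1)), stdSeq_one]
    rw [Finset.sum_congr rfl h3, Finset.sum_const, nsmul_eq_mul, Finset.card_erase_of_mem hx,
      Nat.cast_sub (Finset.card_pos.2 ⟨x, hx⟩), dist_self]
    simp only [stdSeq, Nat.cast_one]
    ring
  rw [Finset.sum_congr rfl h2, Finset.sum_const, nsmul_eq_mul]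

/-- The Delsarte bound for cliques. -/
theorem card_clique_le (h : LargeBeta G D b α β) {C : Finset V}
    (hC : ∀ x ∈ C, ∀ y ∈ C, x ≠ y → G.Adj x y) : (C.card : ℝ) ≤ β + 1 := by
  have h1 := h.quadForm_clique hC
  have h2 := h.beta_pos
  by_contra hlt
  push Not at hlt
  have h3 : 0 ≤ ∑ x, (∑ y ∈ C, stdSeq b α β (G.dist x y)) ^ 2 :=
    Finset.sum_nonneg fun _ _ => sq_nonneg _
  have h4 : 1 - ((C.card : ℝ) - 1) / β < 0 := by
    rw [sub_neg, one_lt_div h2]; linarith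
  have h5 := h.one_le_idemScalar
  have h6 : (C.card : ℝ) * (1 - ((C.card : ℝ) - 1) / β) < 0 :=
    mul_neg_of_pos_of_neg (by linarith) h4
  nlinarith

/-- In the case of equality in the Delsarte bound the clique is completely regular. -/
theorem sum_stdSeq_clique (h : LargeBeta G D b α β) {C : Finset V}
    (hC : ∀ x ∈ C, ∀ y ∈ C, x ≠ y → G.Adj x y) (hcard : (C.card : ℝ) = β + 1) (x : V) :
    ∑ y ∈ C, stdSeq b α β (G.dist x y) = 0 := by
  have h1 := h.quadForm_clique hC
  have h2 := h.beta_pos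
  rw [hcard, add_sub_cancel_right, div_self h2.ne', sub_self, mul_zero, mul_zero] at h1
  have h3 := (Finset.sum_eq_zero_iff_of_nonneg (fun _ _ => sq_nonneg _)).1 h1.symm x
    (Finset.mem_univ x)
  exact pow_eq_zero_iff (two_ne_zero) |>.1 h3

end LargeBeta

end Eigenspace

section LineData

variable {G : SimpleGraph V} {D b : ℕ} {α β : ℝ} {L : Finset (Finset V)} {s : ℕ}

open scoped Classical in
/-- The members of a family of finite sets which contain `x`. -/
noncomputable def linesAt (L : Finset (Finset V)) (x : V) : Finset (Finset V) :=
  L.filter fun ℓ => x ∈ ℓ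

theorem mem_linesAt {x : V} {ℓ : Finset V} : ℓ ∈ linesAt L x ↔ ℓ ∈ L ∧ x ∈ ℓ := by
  simp [linesAt]

variable [Fintype V]

/-- A graph with classical parameters with large `β` together with a system of lines, at most
`s` of them through each point, whose sizes are close to `β + 1`. -/
structure LineData (G : SimpleGraph V) (D b : ℕ) (α β : ℝ) (L : Finset (Finset V)) (s : ℕ) :
    Prop extends LargeBeta G D b α β, IsLineSystem G L where
  card_linesAt_le : ∀ x, (linesAt L x).card ≤ s
  mul_le_beta : (s : ℝ) * ((b + 2) * (α * b + b + α)) ≤ β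
  mul_le_beta' : (s : ℝ) * ((b + 1) * (b ^ 2 + b + 2) - 3) ≤ β
  card_ge : ∀ ℓ ∈ L,
    β + 1 + α * (gauss b D - 1) - (s - 1) * (α * b + b + α) ≤ (ℓ.card : ℝ)

/-- A point all whose lines have `β + 1` points. -/
def IsFull (L : Finset (Finset V)) (β : ℝ) (x : V) : Prop :=
  ∀ ℓ ∈ L, x ∈ ℓ → (ℓ.card : ℝ) = β + 1

namespace LargeBeta

open scoped Classical in
theorem card_commonNbrs_adj (h : LargeBeta G D b α β) {x y : V} (hxy : G.Adj x y) :
    ((commonNbrs G x y).card : ℝ) = β - 1 + α * (gauss b D - 1) := by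
  have h1 := h.sum_adj_dist x y (fun i => if i = 1 then 1 else 0)
  rw [dist_eq_one_iff_adj.2 hxy, ← Finset.sum_filter, Finset.filter_filter, Finset.sum_const,
    nsmul_eq_mul, mul_one] at h1
  have h2 : commonNbrs G x y =
      Finset.univ.filter fun z => G.Adj y z ∧ G.dist x z = 1 := by
    ext z; simp [mem_commonNbrs, and_comm, dist_eq_one_iff_adj]
  rw [h2, h1]
  simp [gauss_one, gauss_zero]
  ring

open scoped Classical in
theorem card_commonNbrs_two (h : LargeBeta G D b α β) {x y : V} (hxy : G.dist x y = 2) :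
    ((commonNbrs G x y).card : ℝ) = (b + 1) * (1 + α) := by
  have h1 := h.card_prev x y
  have h2 : commonNbrs G x y =
      Finset.univ.filter fun z => G.Adj y z ∧ G.dist x z + 1 = G.dist x y := by
    ext z; simp [mem_commonNbrs, and_comm, hxy, dist_eq_one_iff_adj]
  rw [h2, h1, hxy]
  simp [gauss_one, gauss_two]

theorem dist_eq_two (h : LargeBeta G D b α β) {x y z : V} (hne : x ≠ y) (hxy : ¬ G.Adj x y)
    (hxz : G.Adj x z) (hyz : G.Adj y z) : G.dist x y = 2 := by
  have h1 := h.connected.one_lt_dist_of_ne_of_not_adj hne hxy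
  have h2 := h.dist_le_succ (x := x) hyz.symm
  rw [dist_eq_one_iff_adj.2 hxz] at h2
  omega

theorem card_commonNbrs_le (h : LargeBeta G D b α β) {x y : V} (hne : x ≠ y)
    (hxy : ¬ G.Adj x y) : ((commonNbrs G x y).card : ℝ) ≤ (b + 1) * (1 + α) := by
  by_cases h0 : commonNbrs G x y = ∅
  · have := h.alpha_nonneg
    rw [h0, Finset.card_empty, Nat.cast_zero]; positivity
  · obtain ⟨z, hz⟩ := Finset.nonempty_iff_ne_empty.2 h0
    rw [mem_commonNbrs] at hz
    exact (h.card_commonNbrs_two (h.dist_eq_two hne hxy hz.1 hz.2)).le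

theorem exists_lineData (h : LargeBeta G D b α β) : ∃ L s, LineData G D b α β L s := by
  classical
  obtain ⟨x₀⟩ := h.connected.nonempty
  set t : ℝ := (2 * (b : ℝ) + 4) / (2 * b + 3) with ht
  set r := gauss b D with hr
  have hr7 := h.seven_le_gauss
  rw [← hr] at hr7
  have hβ := h.beta_pos
  have hα := h.alpha_nonneg
  have hb : (2 : ℝ) ≤ b := by exact_mod_cast h.two_le
  set M : ℝ := α * b + b + α with hM
  have hM2 : 2 ≤ M := by nlinarith
  have ht1 : 1 ≤ t := by rw [ht, le_div_iff₀ (by positivity)]; linarith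
  have htr : 0 ≤ t * r := by positivity
  set s := ⌊t * r⌋₊ with hs
  have hs1 : (s : ℝ) ≤ t * r := Nat.floor_le htr
  have hs2 : t * r < s + 1 := Nat.lt_floor_add_one _
  have hs7 : (7 : ℝ) ≤ s := by
    have : 7 ≤ s := Nat.le_floor (by push_cast; nlinarith)
    exact_mod_cast this
  set c := ⌊M⌋₊ with hc
  have hc1 : (c : ℝ) ≤ M := Nat.floor_le (by linarith)
  have hb1 : (s : ℝ) * ((b + 2) * M) ≤ β := by
    have := h.le_beta
    calc (s : ℝ) * ((b + 2) * M) ≤ t * r * ((b + 2) * M) := by gcongr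
      _ = t * r * (b + 2) * M := by ring
      _ ≤ β := this
  have hb2 : (s : ℝ) * ((b + 1) * (b ^ 2 + b + 2) - 3) ≤ β := by
    refine le_trans ?_ h.le_beta'
    have : 0 ≤ ((b : ℝ) + 1) * (b ^ 2 + b + 2) - 3 := by nlinarith
    gcongr
  set k := (Finset.univ.filter fun z => G.Adj x₀ z).card with hk
  have hkr : (k : ℝ) = r * β := h.card_adj x₀
  have hdeg : ∀ x, (Finset.univ.filter fun z => G.Adj x z).card = k := by
    intro x
    have h1 := h.card_adj x
    rw [← hr, ← hkr] at h1
    exact_mod_cast h1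
  have hkpos : 0 < k := by
    have : (0 : ℝ) < k := by rw [hkr]; positivity
    exact_mod_cast this
  obtain ⟨y₀, hy₀⟩ := Finset.card_pos.1 hkpos
  have hxy₀ : G.Adj x₀ y₀ := (Finset.mem_filter.1 hy₀).2
  set lam := (commonNbrs G x₀ y₀).card with hlam
  have hlamr : (lam : ℝ) = β - 1 + α * (r - 1) := h.card_commonNbrs_adj hxy₀
  have hlam' : ∀ x y, G.Adj x y → (commonNbrs G x y).card = lam := by
    intro x y hxy
    have h1 := h.card_commonNbrs_adj hxy
    rw [← hr, ← hlamr] at h1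
    exact_mod_cast h1
  have hmu : ∀ x y, x ≠ y → ¬ G.Adj x y → (commonNbrs G x y).card ≤ c + 1 := by
    intro x y hne hxy
    have h1 := h.card_commonNbrs_le hne hxy
    have h2 : (commonNbrs G x y).card - 1 ≤ c := by
      refine Nat.le_floor ?_
      rcases Nat.eq_zero_or_pos (commonNbrs G x y).card with h3 | h3
      · rw [h3]; push_cast; linarith
      · rw [Nat.cast_sub h3]; push_cast; rw [hM]; linarith
    omega
  have hlamβ : β ≤ (lam : ℝ) + 1 := by rw [hlamr]; nlinarith
  have hsc : (s : ℝ) * c ≤ s * M := by gcongr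
  have hsM : (s : ℝ) * M * (b + 2) ≤ β := by linarith
  have hsM0 : 0 ≤ (s : ℝ) * M := by positivity
  have hmain := bigCliques_isLineSystem (G := G) (k := k) (lam := lam) (c := c) (s := s)
    hdeg hlam' hmu
    (by
      have h1 : (s : ℝ) * M ≤ β / (b + 2) := by rw [le_div_iff₀ (by positivity)]; exact hsM
      have h2 : r * β < (s + 1) * (β - β / (b + 2) / 2) := by
        have h3 : β - β / (b + 2) / 2 = β / t := by rw [ht]; field_simp; ring
        rw [h3, ← mul_div_assoc, lt_div_iff₀ (by linarith)]
        nlinarith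
      have h4 : (2 * k + s * (s + 1) * c : ℝ) < 2 * (s + 1) * (lam + 1) := by
        rw [hkr]
        have h5 : ((s : ℝ) + 1) * (s * c) ≤ (s + 1) * (β / (b + 2)) :=
          mul_le_mul_of_nonneg_left (hsc.trans h1) (by positivity)
        have h6 : ((s : ℝ) + 1) * β ≤ (s + 1) * (lam + 1) :=
          mul_le_mul_of_nonneg_left hlamβ (by positivity)
        linarith
      exact_mod_cast h4)
    (by
      have h4 : (2 * s * c : ℝ) < lam + 1 + c := by
        have : (0 : ℝ) ≤ c := by positivity
        nlinarith
      exact_mod_cast h4)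
  refine ⟨bigCliques G lam c s, s, ⟨h, hmain.1, ?_, hb1, hb2, ?_⟩⟩
  · intro x; convert hmain.2 x; ext; simp [mem_linesAt]
  · intro ℓ hℓ
    have h1 : lam + 2 + c ≤ ℓ.card + s * c := (mem_bigCliques.1 hℓ).2.2
    have h2 : (lam + 2 + c : ℝ) ≤ ℓ.card + s * c := by exact_mod_cast h1
    have h3 : ((s : ℝ) - 1) * c ≤ (s - 1) * M := mul_le_mul_of_nonneg_left hc1 (by linarith)
    linarith

end LargeBeta

namespace IsLineSystem

open scoped Classical in
/-- The lines through `y` partition the neighbours of `y`. -/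
theorem sum_linesAt (h : IsLineSystem G L) (y : V) (f : V → ℝ) :
    ∑ ℓ ∈ linesAt L y, ∑ p ∈ ℓ.erase y, f p =
      ∑ p ∈ Finset.univ.filter (fun p => G.Adj y p), f p := by
  rw [← Finset.sum_biUnion]
  · refine Finset.sum_congr ?_ fun _ _ => rfl
    ext p
    simp only [Finset.mem_biUnion, mem_linesAt, Finset.mem_erase, Finset.mem_filter,
      Finset.mem_univ, true_and]
    constructor
    · rintro ⟨ℓ, ⟨hℓ, hy⟩, hne, hp⟩
      exact h.adj ℓ hℓ y hy p hp (Ne.symm hne)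
    · intro hyp
      obtain ⟨ℓ, hℓ, hy, hp⟩ := h.exists_line y p hyp
      exact ⟨ℓ, ⟨hℓ, hy⟩, hyp.ne', hp⟩
  · intro ℓ hℓ ℓ' hℓ' hne
    rw [Finset.mem_coe, mem_linesAt] at hℓ hℓ'
    refine Finset.disjoint_left.2 fun p hp hp' => hne ?_
    rw [Finset.mem_erase] at hp hp'
    exact h.unique ℓ hℓ.1 ℓ' hℓ'.1 y p (Ne.symm hp.1) hℓ.2 hp.2 hℓ'.2 hp'.2

end IsLineSystem

namespace LineData

theorem card_le (h : LineData G D b α β L s) {ℓ : Finset V} (hℓ : ℓ ∈ L) :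
    (ℓ.card : ℝ) ≤ β + 1 :=
  h.card_clique_le (h.adj ℓ hℓ)

theorem card_ge_sub (h : LineData G D b α β L s) {ℓ : Finset V} (hℓ : ℓ ∈ L) :
    β + 1 - s * (α * b + b + α) ≤ (ℓ.card : ℝ) := by
  refine le_trans ?_ (h.card_ge ℓ hℓ)
  have h1 := mul_nonneg h.alpha_nonneg (show 0 ≤ gauss b D - 1 by linarith [h.seven_le_gauss])
  have h2 := mul_nonneg h.alpha_nonneg (show (0 : ℝ) ≤ b by positivity)
  have h3 : (0 : ℝ) ≤ b := by positivity
  linarith [h.alpha_nonneg]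

/-- The defects of the lines through a point. -/
theorem sum_defect (h : LineData G D b α β L s) (x : V) :
    ∑ ℓ ∈ linesAt L x, (β + 1 - (ℓ.card : ℝ)) = β * ((linesAt L x).card - gauss b D) := by
  classical
  have h1 := h.sum_linesAt x (fun _ => 1)
  rw [Finset.sum_const, nsmul_eq_mul, mul_one, h.card_adj] at h1
  have h2 : ∀ ℓ ∈ linesAt L x, ∑ p ∈ ℓ.erase x, (1 : ℝ) = (ℓ.card : ℝ) - 1 := by
    intro ℓ hℓ
    have hx := (mem_linesAt.1 hℓ).2
    rw [Finset.sum_const, nsmul_eq_mul, mul_one, Finset.card_erase_of_mem hx,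
      Nat.cast_sub (Finset.card_pos.2 ⟨x, hx⟩), Nat.cast_one]
  rw [Finset.sum_congr rfl h2] at h1
  simp only [Finset.sum_sub_distrib, Finset.sum_add_distrib, Finset.sum_const, nsmul_eq_mul,
    mul_one] at h1 ⊢
  linarith

theorem gauss_le_card_linesAt (h : LineData G D b α β L s) (x : V) :
    gauss b D ≤ (linesAt L x).card := by
  have h1 : 0 ≤ β * ((linesAt L x).card - gauss b D) := by
    rw [← h.sum_defect x]
    refine Finset.sum_nonneg fun ℓ hℓ => ?_
    have := h.card_le (mem_linesAt.1 hℓ).1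
    linarith
  have h2 := h.beta_pos
  by_contra h3
  push Not at h3
  nlinarith

theorem isFull_of_card_le (h : LineData G D b α β L s) {x : V}
    (hx : ((linesAt L x).card : ℝ) ≤ gauss b D) : IsFull L β x := by
  intro ℓ hℓ hxℓ
  have h1 := h.sum_defect x
  rw [le_antisymm hx (h.gauss_le_card_linesAt x), sub_self, mul_zero] at h1
  have h2 := (Finset.sum_eq_zero_iff_of_nonneg (fun ℓ' hℓ' => by
    have := h.card_le (mem_linesAt.1 hℓ').1
    linarith)).1 h1 ℓ (mem_linesAt.2 ⟨hℓ, hxℓ⟩)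
  linarith

/-- The square norm of the vector of line sums of an eigenfunction. -/
theorem sum_sq_line_sums (h : LineData G D b α β L s) {v : V → ℝ}
    (hv : IsNegEigenfunction G (gauss b D) v) :
    ∑ ℓ ∈ L, (∑ x ∈ ℓ, v x) ^ 2 = ∑ x, ((linesAt L x).card - gauss b D) * v x ^ 2 := by
  classical
  have h1 : ∀ x, ((linesAt L x).card - gauss b D) * v x ^ 2 =
      v x * ∑ ℓ ∈ linesAt L x, ∑ y ∈ ℓ, v y := by
    intro x
    have h2 : ∀ ℓ ∈ linesAt L x, ∑ y ∈ ℓ, v y = v x + ∑ y ∈ ℓ.erase x, v y := fun ℓ hℓ =>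
      (Finset.add_sum_erase ℓ v (mem_linesAt.1 hℓ).2).symm
    rw [Finset.sum_congr rfl h2, Finset.sum_add_distrib, h.sum_linesAt x v, hv x,
      Finset.sum_const, nsmul_eq_mul]
    ring
  rw [Finset.sum_congr rfl fun x _ => h1 x]
  simp only [linesAt, Finset.sum_filter, Finset.mul_sum]
  rw [Finset.sum_comm]
  refine Finset.sum_congr rfl fun ℓ _ => ?_
  rw [sq, Finset.sum_mul_sum, ← Finset.sum_filter_add_sum_filter_not Finset.univ (fun x => x ∈ ℓ)]
  rw [Finset.sum_eq_zero (s := Finset.univ.filter fun x => ¬ x ∈ ℓ), add_zero]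
  · refine Finset.sum_congr (by ext; simp) fun x hx => ?_
    rw [if_pos (Finset.mem_filter.1 hx).2, Finset.mul_sum]
  · intro x hx
    rw [if_neg (Finset.mem_filter.1 hx).2, mul_zero]

theorem sum_card_lines (L : Finset (Finset V)) :
    ∑ ℓ ∈ L, ℓ.card = ∑ x, (linesAt L x).card := by
  classical
  simp only [linesAt, Finset.card_filter]
  rw [Finset.sum_comm]
  refine Finset.sum_congr rfl fun ℓ _ => ?_
  simp

/-- The defects of the lines are at most `β / (b + 2)`. -/
theorem mul_defect_le (h : LineData G D b α β L s) {ℓ : Finset V} (hℓ : ℓ ∈ L) :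
    (b + 2) * (β + 1 - (ℓ.card : ℝ)) ≤ β := by
  have h1 := h.card_ge_sub hℓ
  have h2 := h.mul_le_beta
  have h3 : (b + 2 : ℝ) * (β + 1 - ℓ.card) ≤ (b + 2) * (s * (α * b + b + α)) :=
    mul_le_mul_of_nonneg_left (by linarith) (by positivity)
  linarith

theorem seven_le_s (h : LineData G D b α β L s) : (7 : ℝ) ≤ s := by
  obtain ⟨x⟩ := h.connected.nonempty
  have h1 := h.gauss_le_card_linesAt x
  have h2 : ((linesAt L x).card : ℝ) ≤ s := by exact_mod_cast h.card_linesAt_le x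
  have h3 := h.seven_le_gauss
  linarith

theorem exists_card_linesAt_le (h : LineData G D b α β L s) :
    ∃ x, ((linesAt L x).card : ℝ) ≤ gauss b D := by
  classical
  by_contra hcon
  push Not at hcon
  set N := idemScalar D b α β with hN
  have hN1 := h.one_le_idemScalar
  have hN2 := h.idemScalar_le_two
  rw [← hN] at hN1 hN2
  set M : Matrix V V ℝ := Matrix.of fun x y => stdSeq b α β (G.dist x y) with hM
  have hMv : ∀ v x, Matrix.toLin' M v x = ∑ y, stdSeq b α β (G.dist x y) * v y := by
    intro v x
    simp [Matrix.toLin'_apply, Matrix.mulVec, dotProduct, hM]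
  have heig : ∀ v, IsNegEigenfunction G (gauss b D) (Matrix.toLin' M v) := by
    intro v y
    simp only [hMv]
    rw [Finset.sum_comm, Finset.mul_sum]
    refine Finset.sum_congr rfl fun z _ => ?_
    have := h.isNegEigenfunction_stdSeq z y
    simp only [G.dist_comm (u := z)] at this
    rw [← Finset.sum_mul, this]
    ring
  have hproj : ∀ v ∈ LinearMap.range (Matrix.toLin' M), Matrix.toLin' M v = N • v := by
    rintro _ ⟨w, rfl⟩
    ext x
    rw [hMv, h.sum_stdSeq_mul (heig w) x]
    rfl
  have hIs : LinearMap.IsProj (LinearMap.range (Matrix.toLin' M)) (N⁻¹ • Matrix.toLin' M) := by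
    refine ⟨fun v => ?_, fun v hv => ?_⟩
    · exact Submodule.smul_mem _ _ ⟨v, rfl⟩
    · rw [LinearMap.smul_apply, hproj v hv, smul_smul, inv_mul_cancel₀ (by linarith), one_smul]
  have htr := hIs.trace
  rw [map_smul, Matrix.trace_toLin'_eq] at htr
  have htrM : M.trace = Fintype.card V := by
    simp [Matrix.trace, hM, stdSeq]
  rw [htrM] at htr
  let T : (V → ℝ) →ₗ[ℝ] (L → ℝ) :=
    { toFun := fun v ℓ => ∑ x ∈ ℓ.1, v x
      map_add' := fun v w => by ext ℓ; simp [Finset.sum_add_distrib]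
      map_smul' := fun a v => by ext ℓ; simp [Finset.mul_sum] }
  have hinj : Function.Injective (T ∘ₗ (LinearMap.range (Matrix.toLin' M)).subtype) := by
    rw [← LinearMap.ker_eq_bot, LinearMap.ker_eq_bot']
    rintro ⟨v, w, rfl⟩ hv
    have h1 := h.sum_sq_line_sums (heig w)
    rw [Finset.sum_eq_zero] at h1
    · have h2 := (Finset.sum_eq_zero_iff_of_nonneg (fun x _ =>
        mul_nonneg (by linarith [hcon x]) (sq_nonneg _))).1 h1.symm
      ext x
      have h3 := h2 x (Finset.mem_univ x)
      rcases mul_eq_zero.1 h3 with h4 | h4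
      · linarith [hcon x]
      · exact pow_eq_zero_iff (two_ne_zero) |>.1 h4
    · intro ℓ hℓ
      have := congrFun hv ⟨ℓ, hℓ⟩
      change ∑ x ∈ ℓ, Matrix.toLin' M w x = 0 at this
      rw [this]; simp
  have hrank := LinearMap.finrank_le_finrank_of_injective hinj
  rw [Module.finrank_fintype_fun_eq_card, Fintype.card_coe] at hrank
  have hrank' : (Module.finrank ℝ (LinearMap.range (Matrix.toLin' M)) : ℝ) ≤ L.card := by
    exact_mod_cast hrank
  have hn : (Fintype.card V : ℝ) ≤ 2 * L.card := by
    rw [smul_eq_mul] at htr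
    have h1 : (Fintype.card V : ℝ) = N * (N⁻¹ * Fintype.card V) := by field_simp
    rw [h1, htr]
    have : (0 : ℝ) ≤ L.card := Nat.cast_nonneg _
    nlinarith
  have hnpos : (0 : ℝ) < Fintype.card V := by
    have := h.connected.nonempty
    exact_mod_cast Fintype.card_pos
  have h3 : (∑ ℓ ∈ L, (ℓ.card : ℝ)) ≤ Fintype.card V * s := by
    have h4 : ∑ ℓ ∈ L, ℓ.card ≤ Fintype.card V * s := by
      rw [sum_card_lines]
      refine (Finset.sum_le_card_nsmul _ _ s fun x _ => h.card_linesAt_le x).trans ?_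
      simp
    exact_mod_cast h4
  have hs := h.seven_le_s
  have h5 : (L.card : ℝ) * (6 * s) ≤ ∑ ℓ ∈ L, (ℓ.card : ℝ) := by
    rw [← nsmul_eq_mul]
    refine Finset.card_nsmul_le_sum _ _ _ fun ℓ hℓ => ?_
    have h6 := h.card_ge_sub hℓ
    have h7 := h.mul_le_beta
    have hb : (2 : ℝ) ≤ b := by exact_mod_cast h.two_le
    have hα := h.alpha_nonneg
    have h8 : 2 ≤ α * b + b + α := by nlinarith
    have h9 : 6 ≤ (b + 1) * (α * b + b + α) := by nlinarith
    have h10 : (s : ℝ) * 6 ≤ s * ((b + 1) * (α * b + b + α)) := by gcongr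
    linarith
  nlinarith

/-- Some point is full. -/
theorem exists_isFull (h : LineData G D b α β L s) : ∃ x, IsFull L β x := by
  obtain ⟨x, hx⟩ := h.exists_card_linesAt_le
  exact ⟨x, h.isFull_of_card_le hx⟩

end LineData

end LineData

section Propagation

variable [Fintype V] {G : SimpleGraph V} {D b : ℕ} {α β : ℝ} {L : Finset (Finset V)} {s : ℕ}

open scoped Classical in
/-- Double counting of incident pairs with the point satisfying a predicate. -/
theorem sum_card_filter_mul (T : Finset (Finset V)) (P : V → Prop) [DecidablePred P]
    (F : Finset V → ℝ) :
    ∑ ℓ ∈ T, ((ℓ.filter P).card : ℝ) * F ℓ =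
      ∑ y ∈ Finset.univ.filter P, ∑ ℓ ∈ linesAt T y, F ℓ := by
  have h1 : ∀ ℓ ∈ T, ((ℓ.filter P).card : ℝ) * F ℓ =
      ∑ y ∈ Finset.univ.filter P, if y ∈ ℓ then F ℓ else 0 := by
    intro ℓ _
    rw [← Finset.sum_filter, Finset.filter_filter, Finset.sum_const, nsmul_eq_mul]
    congr 3
    ext y; simp [and_comm]
  rw [Finset.sum_congr rfl h1, Finset.sum_comm]
  refine Finset.sum_congr rfl fun y _ => ?_
  rw [linesAt, Finset.sum_filter]

open scoped Classical in
/-- The lines through `y` all whose points are at distance at most `2` from `x`. -/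
noncomputable def closeLines (G : SimpleGraph V) (L : Finset (Finset V)) (x y : V) :
    Finset (Finset V) :=
  (linesAt L y).filter fun ℓ => ∀ u ∈ ℓ, G.dist x u ≤ 2

theorem mem_closeLines {x y : V} {ℓ : Finset V} :
    ℓ ∈ closeLines G L x y ↔ ℓ ∈ L ∧ y ∈ ℓ ∧ ∀ u ∈ ℓ, G.dist x u ≤ 2 := by
  simp [closeLines, mem_linesAt, and_assoc]

namespace LineData

open scoped Classical in
theorem sum_adj_close (h : LineData G D b α β L s) {x y : V} (hxy : G.dist x y = 2) :
    ∑ ℓ ∈ linesAt L y, (((ℓ.erase y).filter fun u => G.dist x u ≤ 2).card : ℝ) =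
      (b + 1) * β + α * (b + 1) * (gauss b D - b - 1) := by
  have h1 := h.sum_adj_dist x y (fun i => if i ≤ 2 then 1 else 0)
  have h2 := h.sum_linesAt y (fun p => if G.dist x p ≤ 2 then (1 : ℝ) else 0)
  rw [h1, hxy] at h2
  rw [Finset.sum_congr rfl fun ℓ _ => by
    rw [← Finset.sum_filter, Finset.sum_const, nsmul_eq_mul, mul_one]] at h2
  rw [h2]
  simp [gauss_one, gauss_two]
  ring

open scoped Classical in
theorem card_closeLines_le (h : LineData G D b α β L s) {x y : V} (hxy : G.dist x y = 2) :
    (closeLines G L x y).card ≤ b + 1 := by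
  by_contra hlt
  push Not at hlt
  have h1 := h.sum_adj_close hxy
  set M := α * b + b + α with hM
  set m := β + α * (gauss b D - 1) - (s - 1) * M with hm
  have h2 : ((b + 2 : ℕ) : ℝ) * m ≤ (b + 1) * β + α * (b + 1) * (gauss b D - b - 1) := by
    have hα := h.alpha_nonneg
    have hs := h.seven_le_s
    have hm0 : 0 ≤ m := by
      have h3 := h.mul_le_beta
      rw [← hM] at h3
      have h4 := h.seven_le_gauss
      have : 0 ≤ M := by positivity
      have : (s : ℝ) * M ≤ s * ((b + 2) * M) := by
        gcongr
        nlinarith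
      nlinarith
    calc ((b + 2 : ℕ) : ℝ) * m ≤ (closeLines G L x y).card * m := by
          gcongr
          omega
      _ ≤ ∑ ℓ ∈ closeLines G L x y, (((ℓ.erase y).filter fun u => G.dist x u ≤ 2).card : ℝ) := by
          rw [← nsmul_eq_mul]
          refine Finset.card_nsmul_le_sum _ _ _ fun ℓ hℓ => ?_
          obtain ⟨hℓ, hy, hu⟩ := mem_closeLines.1 hℓ
          rw [Finset.filter_true_of_mem fun u hu' => hu u (Finset.mem_of_mem_erase hu'),
            Finset.card_erase_of_mem hy, Nat.cast_sub (Finset.card_pos.2 ⟨y, hy⟩)]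
          have := h.card_ge ℓ hℓ
          push_cast
          linarith
      _ ≤ ∑ ℓ ∈ linesAt L y, (((ℓ.erase y).filter fun u => G.dist x u ≤ 2).card : ℝ) :=
          Finset.sum_le_sum_of_subset_of_nonneg (Finset.filter_subset _ _)
            fun _ _ _ => Nat.cast_nonneg _
      _ = _ := h1
  have h3 := h.mul_le_beta
  rw [← hM] at h3
  have hα := h.alpha_nonneg
  have h4 := h.seven_le_gauss
  have hb : (2 : ℝ) ≤ b := by exact_mod_cast h.two_le
  push_cast at h2
  have h5 : 0 ≤ α * b := by positivity
  have h6 : 0 ≤ α * gauss b D := by positivity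
  have h7 : 0 < M := by linarith
  nlinarith

/-- A line containing a neighbour of `x` is within distance `2` of `x`. -/
theorem mem_closeLines_of_adj (h : LineData G D b α β L s) {x y p : V} {ℓ : Finset V}
    (hℓ : ℓ ∈ L) (hy : y ∈ ℓ) (hp : p ∈ ℓ) (hxp : G.Adj x p) : ℓ ∈ closeLines G L x y := by
  refine mem_closeLines.2 ⟨hℓ, hy, fun u hu => ?_⟩
  have h1 := dist_eq_one_iff_adj.2 hxp
  by_cases hup : u = p
  · subst hup; omega
  · have := h.dist_le_succ (x := x) (h.adj ℓ hℓ p hp u hu (Ne.symm hup))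
    omega

open scoped Classical in
/-- The neighbours of `x` on the lines through `y` at distance at least two from `x`. -/
theorem sum_card_adj (h : LineData G D b α β L s) {x y : V} (hxy : ¬ G.Adj x y) :
    ∑ ℓ ∈ linesAt L y, ((ℓ.filter (G.Adj x)).card : ℝ) = (commonNbrs G x y).card := by
  have h1 := h.sum_linesAt y (fun p => if G.Adj x p then (1 : ℝ) else 0)
  rw [← Finset.sum_filter, Finset.filter_filter, Finset.sum_const, nsmul_eq_mul, mul_one] at h1
  have h2 : commonNbrs G x y = Finset.univ.filter fun z => G.Adj y z ∧ G.Adj x z := by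
    ext z; simp [mem_commonNbrs, and_comm]
  rw [h2, ← h1]
  refine Finset.sum_congr rfl fun ℓ _ => ?_
  rw [← Finset.sum_filter, Finset.sum_const, nsmul_eq_mul, mul_one]
  congr 2
  ext p
  simp only [Finset.mem_filter, Finset.mem_erase]
  constructor
  · rintro ⟨hp, hxp⟩
    exact ⟨⟨fun hpy => hxy (hpy ▸ hxp), hp⟩, hxp⟩
  · rintro ⟨⟨_, hp⟩, hxp⟩
    exact ⟨hp, hxp⟩

end LineData

/-- The termwise inequality comparing the counts on a line. -/
theorem quadratic_bound {B κ a β d m : ℝ} (hB : 4 ≤ B) (hκ : 2 * κ * B = 1)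
    (hd : 0 ≤ d) (hdβ : B * d ≤ β) :
    a * ((β + 1 - d - m) * (m - a)) ≤
      (β + 1 - a) * (m * (m - a)) + a * κ * (m * d) := by
  set w := a - m with hw
  have hκ0 : 0 < κ := by
    by_contra h
    push Not at h
    nlinarith
  have hκ1 : κ ≤ 1 / 8 := by nlinarith
  have h1 : 0 ≤ B * w ^ 2 - (1 + κ) * a * w + κ * a ^ 2 := by
    have h2 : 2 * B * (B * w ^ 2 - (1 + κ) * a * w + κ * a ^ 2) =
        (a - (1 + κ) * (B * w)) ^ 2 + (2 - (1 + κ) ^ 2) * (B * w) ^ 2 := by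
      linear_combination a ^ 2 * hκ
    have h3 : 0 ≤ 2 - (1 + κ) ^ 2 := by nlinarith
    have h4 : 0 ≤ 2 * B * (B * w ^ 2 - (1 + κ) * a * w + κ * a ^ 2) := by
      rw [h2]; positivity
    exact nonneg_of_mul_nonneg_right h4 (by linarith)
  have h5 : 0 ≤ d * (B * w ^ 2 - (1 + κ) * a * w + κ * a ^ 2) := mul_nonneg hd h1
  have h6 : 0 ≤ (β - B * d) * w ^ 2 := mul_nonneg (by linarith) (sq_nonneg _)
  have h7 := sq_nonneg w
  have h8 : (β + 1 - a) * (m * (m - a)) + a * κ * (m * d) -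
      a * ((β + 1 - d - m) * (m - a)) =
      d * (B * w ^ 2 - (1 + κ) * a * w + κ * a ^ 2) + (β - B * d) * w ^ 2 + w ^ 2 := by
    rw [hw]; ring
  linarith

namespace LineData

open scoped Classical in
/-- If `α > 0`, the neighbours of a full point are full. -/
theorem IsFull.of_adj_of_pos (h : LineData G D b α β L s) (hα : 0 < α) {x z : V}
    (hx : IsFull L β x) (hxz : G.Adj x z) : IsFull L β z := by
  set S := L.filter fun ℓ => x ∉ ℓ ∧ (ℓ.filter (G.Adj x)).Nonempty with hS
  set m : Finset V → ℝ := fun ℓ => ((ℓ.filter (G.Adj x)).card : ℝ) with hm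
  set e : V → ℝ := fun z => (linesAt L z).card - gauss b D with he
  set E := ∑ z ∈ Finset.univ.filter (G.Adj x), e z with hE
  have hr := h.seven_le_gauss
  have hβ := h.beta_pos
  have hb : (2 : ℝ) ≤ b := by exact_mod_cast h.two_le
  -- the lines through a neighbour of `x`, except the one through `x`
  have hat : ∀ z, G.Adj x z → ∃ ℓ ∈ L, x ∈ ℓ ∧ z ∈ ℓ ∧ ℓ ∈ linesAt L z ∧
      linesAt S z = (linesAt L z).erase ℓ := by
    intro z hxz
    obtain ⟨ℓ, hℓ, hxℓ, hzℓ⟩ := h.exists_line x z hxz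
    refine ⟨ℓ, hℓ, hxℓ, hzℓ, mem_linesAt.2 ⟨hℓ, hzℓ⟩, ?_⟩
    ext ℓ'
    simp only [mem_linesAt, hS, Finset.mem_filter, Finset.mem_erase]
    constructor
    · rintro ⟨⟨hℓ', hx', _⟩, hz'⟩
      exact ⟨fun hh => hx' (hh ▸ hxℓ), hℓ', hz'⟩
    · rintro ⟨hne, hℓ', hz'⟩
      refine ⟨⟨hℓ', fun hx' => hne ?_, ⟨z, Finset.mem_filter.2 ⟨hz', hxz⟩⟩⟩, hz'⟩
      exact h.unique ℓ' hℓ' ℓ hℓ x z hxz.ne hx' hz' hxℓ hzℓ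
  have hdef : ∑ ℓ ∈ S, m ℓ * (β + 1 - (ℓ.card : ℝ)) = β * E := by
    rw [sum_card_filter_mul, hE, Finset.mul_sum]
    refine Finset.sum_congr rfl fun z hz => ?_
    obtain ⟨ℓ, hℓ, hxℓ, hzℓ, hmem, hat⟩ := hat z (Finset.mem_filter.1 hz).2
    have h1 := h.sum_defect z
    rw [← Finset.add_sum_erase _ _ hmem, hx ℓ hℓ hxℓ, sub_self, zero_add] at h1
    rw [hat, h1]
  have hmm : ∑ ℓ ∈ S, m ℓ * (m ℓ - (1 + α)) = -α * E := by
    rw [sum_card_filter_mul, hE, Finset.mul_sum]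
    refine Finset.sum_congr rfl fun z hz => ?_
    have hxz := (Finset.mem_filter.1 hz).2
    obtain ⟨ℓ, hℓ, hxℓ, hzℓ, hmem, hat⟩ := hat z hxz
    have h1 := h.sum_linesAt z (fun p => if G.Adj x p then (1 : ℝ) else 0)
    rw [← Finset.sum_filter, Finset.filter_filter, Finset.sum_const, nsmul_eq_mul, mul_one] at h1
    have h2 : commonNbrs G x z = Finset.univ.filter fun p => G.Adj z p ∧ G.Adj x p := by
      ext p; simp [mem_commonNbrs, and_comm]
    rw [← h2, h.card_commonNbrs_adj hxz, ← Finset.add_sum_erase _ _ hmem] at h1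
    have h3 : ∑ p ∈ ℓ.erase z, (if G.Adj x p then (1 : ℝ) else 0) = β - 1 := by
      rw [← Finset.sum_filter, Finset.sum_const, nsmul_eq_mul, mul_one]
      have h4 : (ℓ.erase z).filter (fun p => G.Adj x p) = (ℓ.erase z).erase x := by
        ext p
        simp only [Finset.mem_filter, Finset.mem_erase]
        constructor
        · rintro ⟨hp, hxp⟩; exact ⟨hxp.ne', hp⟩
        · rintro ⟨hpx, hp⟩; exact ⟨hp, h.adj ℓ hℓ x hxℓ p hp.2 (Ne.symm hpx)⟩
      have hxz' : x ∈ ℓ.erase z := Finset.mem_erase.2 ⟨hxz.ne, hxℓ⟩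
      have h5 := Finset.card_erase_add_one hxz'
      have h6 := Finset.card_erase_add_one hzℓ
      rw [h4]
      have h7 := hx ℓ hℓ hxℓ
      rw [← h6, ← h5] at h7
      push_cast at h7
      linarith
    rw [h3] at h1
    have h4 : ∀ ℓ' ∈ linesAt S z, m ℓ' - (1 + α) =
        ∑ p ∈ ℓ'.erase z, (if G.Adj x p then (1 : ℝ) else 0) - α := by
      intro ℓ' hℓ'
      have hz' := (mem_linesAt.1 hℓ').2
      rw [← Finset.sum_filter, Finset.sum_const, nsmul_eq_mul, mul_one, Finset.filter_erase]
      have := Finset.card_erase_add_one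
        (show z ∈ ℓ'.filter (G.Adj x) from Finset.mem_filter.2 ⟨hz', hxz⟩)
      simp only [hm]
      rw [← this]
      push_cast
      ring
    rw [Finset.sum_congr rfl h4, hat, Finset.sum_sub_distrib, Finset.sum_const, nsmul_eq_mul]
    have h5 := Finset.card_erase_add_one hmem
    have h6 : (((linesAt L z).erase ℓ).card : ℝ) = (linesAt L z).card - 1 := by
      rw [← h5]; push_cast; ring
    rw [h6]
    simp only [he]
    linarith
  have hnm : 0 ≤ ∑ ℓ ∈ S, ((ℓ.card : ℝ) - m ℓ) * (m ℓ - (1 + α)) := by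
    have h1 : ∀ ℓ ∈ S, ((ℓ.card : ℝ) - m ℓ) * (m ℓ - (1 + α)) =
        ((ℓ.filter fun y => ¬ G.Adj x y).card : ℝ) * (m ℓ - (1 + α)) := by
      intro ℓ _
      have := Finset.card_filter_add_card_filter_not (s := ℓ) (G.Adj x)
      simp only [hm]
      rw [← this]
      push_cast
      ring
    rw [Finset.sum_congr rfl h1, sum_card_filter_mul]
    refine Finset.sum_nonneg fun y hy => ?_
    have hxy := (Finset.mem_filter.1 hy).2
    rcases (linesAt S y).eq_empty_or_nonempty with h0 | ⟨ℓ₀, hℓ₀⟩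
    · rw [h0, Finset.sum_empty]
    · have hd : G.dist x y = 2 := by
        rw [mem_linesAt, hS, Finset.mem_filter] at hℓ₀
        obtain ⟨⟨hℓ₀, hx₀, p, hp⟩, hy₀⟩ := hℓ₀
        rw [Finset.mem_filter] at hp
        refine h.dist_eq_two (fun hh => hx₀ (hh ▸ hy₀)) hxy hp.2 ?_
        exact h.adj ℓ₀ hℓ₀ y hy₀ p hp.1 fun hh => hxy (hh ▸ hp.2)
      have h2 : ((linesAt S y).card : ℝ) ≤ b + 1 := by
        have h3 : linesAt S y ⊆ closeLines G L x y := by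
          intro ℓ hℓ
          rw [mem_linesAt, hS, Finset.mem_filter] at hℓ
          obtain ⟨⟨hℓ, _, p, hp⟩, hy⟩ := hℓ
          rw [Finset.mem_filter] at hp
          exact h.mem_closeLines_of_adj hℓ hy hp.1 hp.2
        exact_mod_cast (Finset.card_le_card h3).trans (h.card_closeLines_le hd)
      have h3 : ∑ ℓ ∈ linesAt S y, m ℓ = (b + 1) * (1 + α) := by
        rw [← h.card_commonNbrs_two hd, ← h.sum_card_adj hxy]
        refine Finset.sum_subset ?_ ?_
        · intro ℓ hℓ
          rw [mem_linesAt, hS, Finset.mem_filter] at hℓ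
          exact mem_linesAt.2 ⟨hℓ.1.1, hℓ.2⟩
        · intro ℓ hℓ hℓ'
          rw [mem_linesAt] at hℓ
          rw [mem_linesAt, hS, Finset.mem_filter] at hℓ'
          simp only [hm]
          rw [Nat.cast_eq_zero, Finset.card_eq_zero, ← Finset.not_nonempty_iff_eq_empty]
          refine fun hne => hℓ' ⟨⟨hℓ.1, fun hxℓ => ?_, hne⟩, hℓ.2⟩
          refine hxy (h.adj ℓ hℓ.1 x hxℓ y hℓ.2 ?_)
          rintro rfl
          simp at hd
      rw [Finset.sum_sub_distrib, Finset.sum_const, nsmul_eq_mul, h3]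
      nlinarith
  have hbound : (1 + α) * ∑ ℓ ∈ S, ((ℓ.card : ℝ) - m ℓ) * (m ℓ - (1 + α)) ≤
      (β + 1 - (1 + α)) * (-α * E) + (1 + α) * (1 / (2 * (b + 2))) * (β * E) := by
    rw [← hmm, ← hdef, Finset.mul_sum, Finset.mul_sum, Finset.mul_sum, ← Finset.sum_add_distrib]
    refine Finset.sum_le_sum fun ℓ hℓ => ?_
    have hℓL := (Finset.mem_filter.1 hℓ).1
    have := quadratic_bound (B := b + 2) (κ := 1 / (2 * (b + 2))) (a := 1 + α) (β := β)
      (d := β + 1 - ℓ.card) (m := m ℓ) (by linarith) (by field_simp)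
      (by linarith [h.card_le hℓL]) (h.mul_defect_le hℓL)
    rwa [show β + 1 - (β + 1 - (ℓ.card : ℝ)) - m ℓ = ℓ.card - m ℓ by ring] at this
  have he0 : ∀ z, 0 ≤ e z := fun z => by
    have := h.gauss_le_card_linesAt z
    simp only [he]; linarith
  have hE0 : 0 ≤ E := Finset.sum_nonneg fun z _ => he0 z
  have hneg : (1 + α) * (1 / (2 * (b + 2))) * β < α * (β - α) := by
    have h1 : 1 ≤ α * (b + 1) := h.alpha_eq_or.resolve_left hα.ne'
    have h2 : (1 + α) * (1 / (2 * (b + 2))) ≤ α / 2 := by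
      rw [mul_one_div, div_le_div_iff₀ (by positivity) (by norm_num)]
      nlinarith
    have h3 := h.gauss_mul_le_beta
    have h4 : 2 * α < β := by nlinarith
    nlinarith
  have hE1 : E ≤ 0 := by
    by_contra hpos
    push Not at hpos
    have h1 := mul_lt_mul_of_pos_right hneg hpos
    have h2 : 0 ≤ (1 + α) * ∑ ℓ ∈ S, ((ℓ.card : ℝ) - m ℓ) * (m ℓ - (1 + α)) := by positivity
    nlinarith
  have hez : e z = 0 := (Finset.sum_eq_zero_iff_of_nonneg fun z _ => he0 z).1
    (le_antisymm hE1 hE0) z (Finset.mem_filter.2 ⟨Finset.mem_univ _, hxz⟩)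
  refine h.isFull_of_card_le ?_
  simp only [he] at hez
  linarith

end LineData

end Propagation

section AlphaZero

variable [Fintype V] {G : SimpleGraph V} {D b : ℕ} {β : ℝ} {L : Finset (Finset V)} {s : ℕ}

theorem stdSeq_zero_alpha (b : ℕ) (β : ℝ) (i : ℕ) : stdSeq b 0 β i = (-1 / β) ^ i := by
  induction i with
  | zero => simp [stdSeq]
  | succ i ih => rw [stdSeq, ih, pow_succ]; ring

namespace LineData

open scoped Classical in
/-- A line with a point far away from `x` has few points close to `x`. -/
theorem card_close_le_of_far (h : LineData G D b 0 β L s) {x u : V} {ℓ : Finset V} (hℓ : ℓ ∈ L)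
    (hu : u ∈ ℓ) (hxu : 2 < G.dist x u) :
    (ℓ.filter fun w => G.dist x w ≤ 2).card ≤ b ^ 2 + b + 1 := by
  have hadj : ∀ w ∈ ℓ.filter (fun w => G.dist x w ≤ 2), G.Adj u w := by
    intro w hw
    rw [Finset.mem_filter] at hw
    exact h.adj ℓ hℓ u hu w hw.1 (by rintro rfl; omega)
  have h3 : ∀ w ∈ ℓ.filter (fun w => G.dist x w ≤ 2), G.dist x u = 3 := by
    intro w hw
    have h1 := h.dist_le_succ (x := x) (hadj w hw).symm
    rw [Finset.mem_filter] at hw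
    omega
  rcases (ℓ.filter fun w => G.dist x w ≤ 2).eq_empty_or_nonempty with h0 | ⟨w₀, hw₀⟩
  · rw [h0]; simp
  · have hxu3 := h3 w₀ hw₀
    have h1 := h.card_prev x u
    rw [hxu3, gauss_three, zero_mul, add_zero, mul_one] at h1
    have h2 : (Finset.univ.filter fun z => G.Adj u z ∧ G.dist x z + 1 = 3).card =
        b ^ 2 + b + 1 := by exact_mod_cast h1
    rw [← h2]
    refine Finset.card_le_card fun w hw => ?_
    have h4 := h.dist_le_succ (x := x) (hadj w hw).symm
    refine Finset.mem_filter.2 ⟨Finset.mem_univ _, hadj w hw, ?_⟩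
    rw [Finset.mem_filter] at hw
    omega

/-- Close lines through a point at distance `2` in the case `α = 0`. -/
theorem card_closeLines (h : LineData G D b 0 β L s) {x y : V} (hxy : G.dist x y = 2) :
    (closeLines G L x y).card = b + 1 := by
  classical
  refine le_antisymm (h.card_closeLines_le hxy) ?_
  by_contra hlt
  have hlt' : (closeLines G L x y).card ≤ b := by omega
  have hlt'' : ((closeLines G L x y).card : ℝ) ≤ b := by exact_mod_cast hlt'
  have h1 := h.sum_adj_close hxy
  have hβ := h.beta_pos
  have h2 : ∀ ℓ ∈ linesAt L y, (((ℓ.erase y).filter fun u => G.dist x u ≤ 2).card : ℝ) ≤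
      (if ∀ u ∈ ℓ, G.dist x u ≤ 2 then β else 0) + (b ^ 2 + b) := by
    intro ℓ hℓ
    obtain ⟨hℓ, hy⟩ := mem_linesAt.1 hℓ
    split_ifs with hclose
    · have h3 : (((ℓ.erase y).filter fun u => G.dist x u ≤ 2).card : ℝ) ≤ (ℓ.erase y).card := by
        exact_mod_cast Finset.card_filter_le _ _
      have h4 := Finset.card_erase_add_one hy
      have h5 := h.card_le hℓ
      rw [← h4] at h5
      push_cast at h5
      have : (0 : ℝ) ≤ (b : ℝ) ^ 2 + b := by positivity
      linarith
    · push Not at hclose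
      obtain ⟨u, hu, hxu⟩ := hclose
      have h3 := h.card_close_le_of_far hℓ hu hxu
      have h4 := Finset.card_erase_add_one
        (show y ∈ ℓ.filter fun w => G.dist x w ≤ 2 from Finset.mem_filter.2 ⟨hy, hxy.le⟩)
      rw [← Finset.filter_erase] at h4
      have h5 : ((ℓ.erase y).filter fun u => G.dist x u ≤ 2).card ≤ b ^ 2 + b := by omega
      rw [zero_add]
      exact_mod_cast h5
  have h3 := Finset.sum_le_sum h2
  rw [h1, Finset.sum_add_distrib, ← Finset.sum_filter, Finset.sum_const, Finset.sum_const,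
    nsmul_eq_mul, nsmul_eq_mul] at h3
  change _ ≤ ((closeLines G L x y).card : ℝ) * β + _ at h3
  have h4 : ((linesAt L y).card : ℝ) ≤ s := by exact_mod_cast h.card_linesAt_le y
  have h5 : ((linesAt L y).card : ℝ) * (b ^ 2 + b) ≤ s * (b ^ 2 + b) := by gcongr
  have h6 : ((closeLines G L x y).card : ℝ) * β ≤ b * β := by gcongr
  have h7 := h.mul_le_beta'
  have h8 := h.seven_le_s
  have hb : (2 : ℝ) ≤ b := by exact_mod_cast h.two_le
  have h9 : (b : ℝ) ^ 2 + b < (b + 1) * (b ^ 2 + b + 2) - 3 := by nlinarith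
  have h10 := mul_lt_mul_of_pos_left h9 (show (0 : ℝ) < s by linarith)
  linarith

/-- Sizes of lines in the case `α = 0`. -/
theorem lt_card (h : LineData G D b 0 β L s) {ℓ : Finset V} (hℓ : ℓ ∈ L) :
    s * (b ^ 2 + b + 1) + b + 1 < ℓ.card := by
  have h1 := h.card_ge ℓ hℓ
  have h2 := h.mul_le_beta'
  have h3 := h.seven_le_s
  have hb : (2 : ℝ) ≤ b := by exact_mod_cast h.two_le
  have h4 : (b : ℝ) ^ 2 + b + 1 < (b + 1) * (b ^ 2 + b + 2) - 3 - b := by nlinarith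
  have h5 := mul_lt_mul_of_pos_left h4 (show (0 : ℝ) < s by linarith)
  have h6 : (s * (b ^ 2 + b + 1) + b + 1 : ℝ) < ℓ.card := by linarith
  exact_mod_cast h6

open scoped Classical in
theorem card_commonNbrs_eq (h : LineData G D b 0 β L s) {x y : V} (hxy : G.dist x y = 2) :
    (commonNbrs G x y).card = b + 1 := by
  have h1 := h.card_commonNbrs_two hxy
  rw [add_zero, mul_one] at h1
  exact_mod_cast h1

/-- The lines through `p` close to a point `y` at distance `2` on a line close to `p` do not
depend on `y`. -/
theorem closeLines_eq (h : LineData G D b 0 β L s) {p y w : V} {ℓ' : Finset V} (hℓ' : ℓ' ∈ L)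
    (hp : p ∉ ℓ') (hclose : ∀ u ∈ ℓ', G.dist p u ≤ 2) (hy : y ∈ ℓ') (hw : w ∈ ℓ')
    (hpy : G.dist p y = 2) (hpw : G.dist p w = 2) :
    closeLines G L y p = closeLines G L w p := by
  classical
  set W := ℓ'.filter fun w => G.dist p w = 2 with hW
  have hWdist : ∀ v ∈ W, G.dist v p = 2 := fun v hv => by
    rw [G.dist_comm]; exact (Finset.mem_filter.1 hv).2
  set A := (linesAt L p).filter fun ℓ => ∀ v ∈ W, ℓ ∈ closeLines G L v p with hA
  have hAsub : ∀ v ∈ W, A ⊆ closeLines G L v p := fun v hv ℓ hℓ =>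
    (Finset.mem_filter.1 hℓ).2 v hv
  have hfew : ∀ ℓ ∈ linesAt L p, ℓ ∉ A →
      (W.filter fun v => ℓ ∈ closeLines G L v p).card ≤ b ^ 2 + b + 1 := by
    intro ℓ hℓ hℓA
    have h1 : ¬ ∀ v ∈ W, ℓ ∈ closeLines G L v p := fun hh =>
      hℓA (Finset.mem_filter.2 ⟨hℓ, hh⟩)
    push Not at h1
    obtain ⟨v, hv, hvℓ⟩ := h1
    rw [mem_linesAt] at hℓ
    have h2 : ¬ ∀ u ∈ ℓ, G.dist v u ≤ 2 := fun hh => hvℓ (mem_closeLines.2 ⟨hℓ.1, hℓ.2, hh⟩)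
    push Not at h2
    obtain ⟨u, hu, hvu⟩ := h2
    rw [G.dist_comm] at hvu
    refine le_trans (Finset.card_le_card fun q hq => ?_)
      (h.card_close_le_of_far hℓ' (Finset.mem_filter.1 hv).1 hvu)
    rw [Finset.mem_filter] at hq ⊢
    refine ⟨(Finset.mem_filter.1 hq.1).1, ?_⟩
    rw [G.dist_comm]
    exact (mem_closeLines.1 hq.2).2.2 u hu
  have hcount : ∑ ℓ ∈ linesAt L p, (W.filter fun v => ℓ ∈ closeLines G L v p).card =
      (b + 1) * W.card := by
    simp only [Finset.card_filter]
    rw [Finset.sum_comm]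
    have : ∀ v ∈ W, ∑ ℓ ∈ linesAt L p, (if ℓ ∈ closeLines G L v p then 1 else 0) = b + 1 := by
      intro v hv
      rw [← h.card_closeLines (hWdist v hv), ← Finset.card_filter]
      congr 1
      ext ℓ
      simp only [Finset.mem_filter, mem_closeLines, mem_linesAt]
      tauto
    rw [Finset.sum_congr rfl this, Finset.sum_const, smul_eq_mul, mul_comm]
  have hWcard : s * (b ^ 2 + b + 1) < W.card := by
    have h1 := h.lt_card hℓ'
    have h2 : ℓ'.card ≤ W.card + (commonNbrs G p y).card := by
      refine (Finset.card_le_card fun q hq => ?_).trans (Finset.card_union_le _ _)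
      rw [Finset.mem_union, hW, Finset.mem_filter, mem_commonNbrs]
      by_cases hq2 : G.dist p q = 2
      · exact Or.inl ⟨hq, hq2⟩
      · right
        have h3 : p ≠ q := fun hh => hp (hh ▸ hq)
        have h4 := h.connected.pos_dist_of_ne h3
        have h5 := hclose q hq
        have h6 : G.dist p q = 1 := by omega
        refine ⟨dist_eq_one_iff_adj.1 h6, h.adj ℓ' hℓ' y hy q hq ?_⟩
        rintro rfl
        omega
    rw [h.card_commonNbrs_eq hpy] at h2
    omega
  have hAcard : b + 1 ≤ A.card := by
    by_contra hlt
    have h1 : ∑ ℓ ∈ linesAt L p, (W.filter fun v => ℓ ∈ closeLines G L v p).card ≤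
        b * W.card + s * (b ^ 2 + b + 1) := by
      calc _ ≤ ∑ ℓ ∈ linesAt L p, ((if ∀ v ∈ W, ℓ ∈ closeLines G L v p then W.card else 0) +
              (b ^ 2 + b + 1)) := by
            refine Finset.sum_le_sum fun ℓ hℓ => ?_
            split_ifs with hh
            · exact (Finset.card_filter_le _ _).trans (Nat.le_add_right _ _)
            · rw [zero_add]
              exact hfew ℓ hℓ fun hℓA => hh (Finset.mem_filter.1 hℓA).2
        _ = A.card * W.card + (linesAt L p).card * (b ^ 2 + b + 1) := by
            rw [Finset.sum_add_distrib, ← Finset.sum_filter, Finset.sum_const, Finset.sum_const,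
              smul_eq_mul, smul_eq_mul]
        _ ≤ _ := by
            gcongr
            · omega
            · exact h.card_linesAt_le p
    rw [hcount] at h1
    nlinarith
  have hEq : ∀ v ∈ W, A = closeLines G L v p := fun v hv =>
    Finset.eq_of_subset_of_card_le (hAsub v hv) (by rw [h.card_closeLines (hWdist v hv)]; exact hAcard)
  rw [← hEq y (Finset.mem_filter.2 ⟨hy, hpy⟩), ← hEq w (Finset.mem_filter.2 ⟨hw, hpw⟩)]

open scoped Classical in
/-- A point within distance `2` of all points of a full line has exactly one neighbour on it. -/
theorem card_adj_eq_one (h : LineData G D b 0 β L s) {ℓ : Finset V} (hℓ : ℓ ∈ L)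
    (hcard : (ℓ.card : ℝ) = β + 1) {w : V} (hw : w ∉ ℓ) (hclose : ∀ u ∈ ℓ, G.dist w u ≤ 2) :
    (ℓ.filter (G.Adj w)).card = 1 := by
  have hβ := h.beta_pos
  have h1 := h.sum_stdSeq_clique (h.adj ℓ hℓ) hcard w
  have h2 : ∀ u ∈ ℓ, stdSeq b 0 β (G.dist w u) =
      (if G.Adj w u then -1 / β - (-1 / β) ^ 2 else 0) + (-1 / β) ^ 2 := by
    intro u hu
    have h3 := hclose u hu
    have h4 := h.connected.pos_dist_of_ne (fun hh : w = u => hw (hh ▸ hu))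
    rw [stdSeq_zero_alpha]
    split_ifs with hwu
    · rw [dist_eq_one_iff_adj.2 hwu]; ring
    · have h5 : G.dist w u ≠ 1 := fun hh => hwu (dist_eq_one_iff_adj.1 hh)
      rw [show G.dist w u = 2 by omega]; ring
  rw [Finset.sum_congr rfl h2, Finset.sum_add_distrib, ← Finset.sum_filter, Finset.sum_const,
    Finset.sum_const, nsmul_eq_mul, nsmul_eq_mul, hcard] at h1
  have h3 : (((ℓ.filter (G.Adj w)).card : ℝ) - 1) * (β + 1) = 0 := by
    field_simp at h1
    linarith
  rcases mul_eq_zero.1 h3 with h4 | h4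
  · have h5 : ((ℓ.filter (G.Adj w)).card : ℝ) = 1 := by linarith
    exact_mod_cast h5
  · linarith

/-- A point adjacent to a point of a line is within distance `2` of the line. -/
theorem dist_le_two_of_adj (h : LineData G D b 0 β L s) {ℓ : Finset V} (hℓ : ℓ ∈ L) {w q : V}
    (hq : q ∈ ℓ) (hwq : G.Adj w q) : ∀ u ∈ ℓ, G.dist w u ≤ 2 :=
  (mem_closeLines.1 (h.mem_closeLines_of_adj hℓ hq hq hwq)).2.2

/-- A point off a full line has at most one neighbour on it. -/
theorem eq_of_adj (h : LineData G D b 0 β L s) {ℓ : Finset V} (hℓ : ℓ ∈ L)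
    (hcard : (ℓ.card : ℝ) = β + 1) {w p q : V} (hw : w ∉ ℓ) (hp : p ∈ ℓ) (hq : q ∈ ℓ)
    (hwp : G.Adj w p) (hwq : G.Adj w q) : p = q := by
  classical
  have h1 := h.card_adj_eq_one hℓ hcard hw (h.dist_le_two_of_adj hℓ hp hwp)
  exact Finset.card_le_one.1 h1.le p (Finset.mem_filter.2 ⟨hp, hwp⟩) q
    (Finset.mem_filter.2 ⟨hq, hwq⟩)

/-- A point within distance `2` of all points of a full line has a neighbour on it. -/
theorem exists_adj (h : LineData G D b 0 β L s) {ℓ : Finset V} (hℓ : ℓ ∈ L)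
    (hcard : (ℓ.card : ℝ) = β + 1) {w : V} (hw : w ∉ ℓ) (hclose : ∀ u ∈ ℓ, G.dist w u ≤ 2) :
    ∃ q ∈ ℓ, G.Adj w q := by
  classical
  have h1 := h.card_adj_eq_one hℓ hcard hw hclose
  obtain ⟨q, hq⟩ := Finset.card_pos.1 (by rw [h1]; exact one_pos)
  exact ⟨q, (Finset.mem_filter.1 hq).1, (Finset.mem_filter.1 hq).2⟩

end LineData

end AlphaZero

section Conclusion

theorem exists_adj_dist_eq_of_dist_eq_succ {G : SimpleGraph V} (hG : G.Connected) {x y : V} {i : ℕ}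
    (h : G.dist x y = i + 1) : ∃ z, G.Adj y z ∧ G.dist x z = i := by
  obtain ⟨p, hp⟩ := hG.exists_walk_length_eq_dist y x
  rw [dist_comm, h] at hp
  cases p with
  | nil => simp at hp
  | @cons _ z _ hyz q =>
    refine ⟨z, hyz, ?_⟩
    rw [Walk.length_cons] at hp
    have h1 : G.dist z x ≤ q.length := dist_le q
    have h2 := hG.dist_triangle (u := x) (v := z) (w := y)
    rw [dist_eq_one_iff_adj.2 hyz.symm] at h2
    rw [dist_comm] at h1
    omega

theorem exists_dist_eq_of_le {G : SimpleGraph V} (hG : G.Connected) {x y : V} {i : ℕ} (h : i ≤ G.dist x y) :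
    ∃ z, G.dist x z = i := by
  obtain ⟨j, hj⟩ := Nat.exists_eq_add_of_le h
  induction j generalizing y with
  | zero => exact ⟨y, hj⟩
  | succ j ih =>
    obtain ⟨z, -, hz⟩ := exists_adj_dist_eq_of_dist_eq_succ hG (i := i + j) hj
    exact ih (by omega) hz

variable [Fintype V] {G : SimpleGraph V} {D b : ℕ} {α β : ℝ} {L : Finset (Finset V)} {s : ℕ}

open scoped Classical in
/-- The lines other than `ℓ` all whose points are on `ℓ` or collinear with a point of `ℓ`. -/
noncomputable def nearLines (G : SimpleGraph V) (L : Finset (Finset V)) (ℓ : Finset V) :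
    Finset (Finset V) :=
  L.filter fun ℓ' => ℓ' ≠ ℓ ∧ ∀ w ∈ ℓ', w ∈ ℓ ∨ ∃ q ∈ ℓ, G.Adj w q

namespace LineData

open scoped Classical in
/-- The near lines of a full line `ℓ ∋ p` through a point `y` at distance `2` from `p` are the
lines through `y` close to `p`. -/
theorem linesAt_nearLines (h : LineData G D b 0 β L s) {ℓ : Finset V} (hℓ : ℓ ∈ L)
    (hcard : (ℓ.card : ℝ) = β + 1) {p y : V} (hp : p ∈ ℓ) (hne : p ≠ y) (hpy : ¬ G.Adj p y)
    (hnear : ∃ q ∈ ℓ, G.Adj y q) :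
    G.dist p y = 2 ∧
      linesAt ((nearLines G L ℓ).filter fun ℓ' => p ∉ ℓ') y = closeLines G L p y := by
  have hyℓ : y ∉ ℓ := fun hy => hpy (h.adj ℓ hℓ p hp y hy hne)
  obtain ⟨q, hq, hyq⟩ := hnear
  have hqp : q ≠ p := by rintro rfl; exact hpy hyq.symm
  have hd : G.dist p y = 2 :=
    h.dist_eq_two hne hpy (h.adj ℓ hℓ p hp q hq (Ne.symm hqp)) hyq
  refine ⟨hd, ?_⟩
  ext ℓ'
  simp only [mem_linesAt, Finset.mem_filter, nearLines, mem_closeLines]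
  constructor
  · rintro ⟨⟨⟨hℓ', _, hall⟩, _⟩, hy⟩
    refine ⟨hℓ', hy, fun u hu => ?_⟩
    rcases hall u hu with hu' | ⟨q', hq', huq'⟩
    · by_cases hup : u = p
      · subst hup; simp
      · have := dist_eq_one_iff_adj.2 (h.adj ℓ hℓ p hp u hu' (Ne.symm hup))
        omega
    · rw [G.dist_comm]
      exact h.dist_le_two_of_adj hℓ hq' huq' p hp
  · rintro ⟨hℓ', hy, hclose⟩
    have hpℓ' : p ∉ ℓ' := fun hp' => hpy (h.adj ℓ' hℓ' p hp' y hy hne)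
    refine ⟨⟨⟨hℓ', fun hh => hyℓ (hh ▸ hy), fun w hw => ?_⟩, hpℓ'⟩, hy⟩
    by_cases hwℓ : w ∈ ℓ
    · exact Or.inl hwℓ
    right
    by_cases hpw : G.Adj p w
    · exact ⟨p, hp, hpw.symm⟩
    have hd' : G.dist p w = 2 := by
      have h1 := h.connected.one_lt_dist_of_ne_of_not_adj
        (fun hh : p = w => hpℓ' (hh ▸ hw)) hpw
      have h2 := hclose w hw
      omega
    have h1 := h.closeLines_eq hℓ' hpℓ' hclose hy hw hd hd'
    have h2 : ℓ ∈ closeLines G L y p := h.mem_closeLines_of_adj hℓ hp hq hyq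
    rw [h1] at h2
    exact h.exists_adj hℓ hcard hwℓ (mem_closeLines.1 h2).2.2

open scoped Classical in
theorem sum_nearLines_eq_zero (h : LineData G D b 0 β L s) {ℓ : Finset V} (hℓ : ℓ ∈ L)
    (hcard : (ℓ.card : ℝ) = β + 1) {p : V} (hp : p ∈ ℓ) :
    ∑ ℓ' ∈ (nearLines G L ℓ).filter (fun ℓ' => p ∉ ℓ'),
      ((ℓ'.card : ℝ) - (ℓ'.filter (G.Adj p)).card) * ((ℓ'.filter (G.Adj p)).card - 1) = 0 := by
  have h1 : ∀ ℓ' ∈ (nearLines G L ℓ).filter (fun ℓ' => p ∉ ℓ'),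
      ((ℓ'.card : ℝ) - (ℓ'.filter (G.Adj p)).card) * ((ℓ'.filter (G.Adj p)).card - 1) =
        ((ℓ'.filter fun y => ¬ G.Adj p y).card : ℝ) * ((ℓ'.filter (G.Adj p)).card - 1) := by
    intro ℓ' _
    have h2 : ((ℓ'.filter (G.Adj p)).card : ℝ) + (ℓ'.filter fun y => ¬ G.Adj p y).card =
        ℓ'.card := by exact_mod_cast Finset.card_filter_add_card_filter_not (s := ℓ') (G.Adj p)
    rw [← h2]
    ring
  rw [Finset.sum_congr rfl h1, sum_card_filter_mul _ _
    (fun ℓ' : Finset V => ((ℓ'.filter (G.Adj p)).card : ℝ) - 1)]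
  refine Finset.sum_eq_zero fun y hy => ?_
  have hpy := (Finset.mem_filter.1 hy).2
  set T := (nearLines G L ℓ).filter (fun ℓ' => p ∉ ℓ') with hT
  rcases (linesAt T y).eq_empty_or_nonempty with h0 | ⟨ℓ₀, hℓ₀⟩
  · rw [h0, Finset.sum_empty]
  · have hne : p ≠ y := by
      rintro rfl
      rw [mem_linesAt, hT, Finset.mem_filter] at hℓ₀
      exact hℓ₀.1.2 hℓ₀.2
    have hnear : ∃ q ∈ ℓ, G.Adj y q := by
      rw [mem_linesAt, hT, Finset.mem_filter, nearLines, Finset.mem_filter] at hℓ₀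
      refine (hℓ₀.1.1.2.2 y hℓ₀.2).resolve_left fun hyℓ => ?_
      exact hpy (h.adj ℓ hℓ p hp y hyℓ hne)
    obtain ⟨hd, hEq⟩ := h.linesAt_nearLines hℓ hcard hp hne hpy hnear
    rw [hEq, Finset.sum_sub_distrib, Finset.sum_const, nsmul_eq_mul, h.card_closeLines hd]
    have h2 := h.sum_card_adj hpy
    rw [h.card_commonNbrs_eq hd] at h2
    have h3 : ∑ ℓ' ∈ closeLines G L p y, ((ℓ'.filter (G.Adj p)).card : ℝ) =
        ∑ ℓ' ∈ linesAt L y, ((ℓ'.filter (G.Adj p)).card : ℝ) := by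
      refine Finset.sum_subset (Finset.filter_subset _ _) fun ℓ' hℓ' hnot => ?_
      rw [Nat.cast_eq_zero, Finset.card_eq_zero, ← Finset.not_nonempty_iff_eq_empty]
      rintro ⟨q, hq⟩
      rw [Finset.mem_filter] at hq
      rw [mem_linesAt] at hℓ'
      exact hnot (h.mem_closeLines_of_adj hℓ'.1 hℓ'.2 hq.1 hq.2)
    rw [h3, h2]
    ring

open scoped Classical in
/-- The total excess of a near line over a full line. -/
theorem sum_excess (h : LineData G D b 0 β L s) {ℓ ℓ' : Finset V} (hℓ : ℓ ∈ L)
    (hcard : (ℓ.card : ℝ) = β + 1) (hℓ' : ℓ' ∈ nearLines G L ℓ) :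
    ∑ p ∈ ℓ.filter (fun p => p ∉ ℓ'), (((ℓ'.filter (G.Adj p)).card : ℝ) - 1) =
      if Disjoint ℓ ℓ' then (ℓ'.card : ℝ) - (β + 1) else 0 := by
  obtain ⟨hℓ'L, hne, hall⟩ := Finset.mem_filter.1 hℓ'
  split_ifs with hdis
  · rw [Finset.filter_true_of_mem fun p hp => Finset.disjoint_left.1 hdis hp,
      Finset.sum_sub_distrib, Finset.sum_const, nsmul_eq_mul, mul_one, hcard]
    congr 1
    simp only [Finset.card_filter, Nat.cast_sum]
    rw [Finset.sum_comm]
    have h1 : ∀ w ∈ ℓ', ∑ p ∈ ℓ, ((if G.Adj p w then 1 else 0 : ℕ) : ℝ) = 1 := by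
      intro w hw
      have hwℓ : w ∉ ℓ := Finset.disjoint_right.1 hdis hw
      obtain ⟨q, hq, hwq⟩ := (hall w hw).resolve_left hwℓ
      have h2 := h.card_adj_eq_one hℓ hcard hwℓ (h.dist_le_two_of_adj hℓ hq hwq)
      rw [Finset.card_filter] at h2
      simp only [G.adj_comm _ w]
      exact_mod_cast h2
    rw [Finset.sum_congr rfl h1]
    simp
  · rw [Finset.not_disjoint_iff] at hdis
    obtain ⟨u, hu, hu'⟩ := hdis
    refine Finset.sum_eq_zero fun p hp => ?_
    rw [Finset.mem_filter] at hp
    have hpu : p ≠ u := by rintro rfl; exact hp.2 hu'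
    have h1 : ℓ'.filter (G.Adj p) = {u} := by
      ext w
      rw [Finset.mem_filter, Finset.mem_singleton]
      constructor
      · rintro ⟨hw, hpw⟩
        by_contra hwu
        have hwℓ : w ∉ ℓ := fun hwℓ => hne (h.unique ℓ' hℓ'L ℓ hℓ w u hwu hw hu' hwℓ hu)
        exact hpu (h.eq_of_adj hℓ hcard hwℓ hp.1 hu hpw.symm
          (h.adj ℓ' hℓ'L w hw u hu' hwu))
      · rintro rfl
        exact ⟨hu', h.adj ℓ hℓ p hp.1 w hu hpu⟩
    rw [h1, Finset.card_singleton, Nat.cast_one, sub_self]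

/-- A line disjoint from a full line all whose points are collinear with points of that line
has `β + 1` points. -/
theorem card_eq_of_near (h : LineData G D b 0 β L s) {ℓ ℓ' : Finset V} (hℓ : ℓ ∈ L)
    (hcard : (ℓ.card : ℝ) = β + 1) (hℓ' : ℓ' ∈ L) (hdis : Disjoint ℓ ℓ')
    (hall : ∀ w ∈ ℓ', ∃ q ∈ ℓ, G.Adj w q) : (ℓ'.card : ℝ) = β + 1 := by
  classical
  set F := nearLines G L ℓ with hF
  have hpos : ∀ ℓ' ∈ F, (0 : ℝ) < ℓ'.card := fun ℓ' hℓ' => by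
    have := h.lt_card (Finset.mem_filter.1 hℓ').1
    have h2 : 0 < ℓ'.card := by omega
    exact_mod_cast h2
  have hmem : ℓ' ∈ F := by
    refine Finset.mem_filter.2 ⟨hℓ', ?_, fun w hw => Or.inr (hall w hw)⟩
    rintro rfl
    rw [disjoint_self] at hdis
    have := h.lt_card hℓ
    rw [hdis, Finset.bot_eq_empty, Finset.card_empty] at this
    omega
  have h1 : 0 ≤ ∑ p ∈ ℓ, ∑ ℓ' ∈ F.filter (fun ℓ' => p ∉ ℓ'),
      (ℓ'.card : ℝ) * (((ℓ'.filter (G.Adj p)).card : ℝ) - 1) := by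
    refine Finset.sum_nonneg fun p hp => ?_
    have h2 := h.sum_nearLines_eq_zero hℓ hcard hp
    simp only [sub_mul] at h2
    rw [Finset.sum_sub_distrib, sub_eq_zero] at h2
    rw [h2]
    refine Finset.sum_nonneg fun ℓ' _ => ?_
    rcases Nat.eq_zero_or_pos (ℓ'.filter (G.Adj p)).card with h3 | h3
    · rw [h3]; simp
    · have : (1 : ℝ) ≤ (ℓ'.filter (G.Adj p)).card := by exact_mod_cast h3
      exact mul_nonneg (Nat.cast_nonneg _) (by linarith)
  have h2 : ∑ p ∈ ℓ, ∑ ℓ' ∈ F.filter (fun ℓ' => p ∉ ℓ'),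
      (ℓ'.card : ℝ) * (((ℓ'.filter (G.Adj p)).card : ℝ) - 1) =
      ∑ ℓ' ∈ F, (ℓ'.card : ℝ) * (if Disjoint ℓ ℓ' then (ℓ'.card : ℝ) - (β + 1) else 0) := by
    rw [Finset.sum_comm' (t' := F) (s' := fun ℓ' => ℓ.filter fun p => p ∉ ℓ')]
    · refine Finset.sum_congr rfl fun ℓ' hℓ' => ?_
      rw [← h.sum_excess hℓ hcard hℓ', Finset.mul_sum]
    · intro p ℓ'
      simp only [Finset.mem_filter]
      tauto
  rw [h2] at h1
  have h3 : ∀ ℓ' ∈ F, (ℓ'.card : ℝ) * (if Disjoint ℓ ℓ' then (ℓ'.card : ℝ) - (β + 1) else 0) ≤ 0 := by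
    intro ℓ' hℓ'
    refine mul_nonpos_of_nonneg_of_nonpos (Nat.cast_nonneg _) ?_
    split_ifs
    · have := h.card_le (Finset.mem_filter.1 hℓ').1
      linarith
    · exact le_rfl
  have h4 := (Finset.sum_eq_zero_iff_of_nonpos h3).1
    (le_antisymm (Finset.sum_nonpos h3) h1) ℓ' hmem
  rw [if_pos hdis] at h4
  rcases mul_eq_zero.1 h4 with h5 | h5
  · exact absurd h5 (hpos ℓ' hmem).ne'
  · linarith

/-- If `α = 0`, the neighbours of a full point are full. -/
theorem IsFull.of_adj_of_zero (h : LineData G D b 0 β L s) {x z : V} (hx : IsFull L β x)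
    (hxz : G.Adj x z) : IsFull L β z := by
  classical
  intro ℓ' hℓ' hz
  by_cases hxℓ' : x ∈ ℓ'
  · exact hx ℓ' hℓ' hxℓ'
  obtain ⟨ℓ₀, hℓ₀, hx₀, hz₀⟩ := h.exists_line x z hxz
  have hcard₀ := hx ℓ₀ hℓ₀ hx₀
  have hne₀ : ℓ' ≠ ℓ₀ := fun hh => hxℓ' (hh ▸ hx₀)
  have hnadj : ∀ w ∈ ℓ', w ≠ z → ¬ G.Adj x w := by
    intro w hw hwz hxw
    have hw₀ : w ∉ ℓ₀ := fun hw₀ => hne₀ (h.unique ℓ' hℓ' ℓ₀ hℓ₀ w z hwz hw hz hw₀ hz₀)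
    exact hxz.ne (h.eq_of_adj hℓ₀ hcard₀ hw₀ hx₀ hz₀ hxw.symm (h.adj ℓ' hℓ' w hw z hz hwz))
  have hdist : ∀ w ∈ ℓ', w ≠ z → G.dist x w = 2 := by
    intro w hw hwz
    exact h.dist_eq_two (fun hh => hxℓ' (hh ▸ hw)) (hnadj w hw hwz) hxz
      (h.adj ℓ' hℓ' w hw z hz hwz)
  obtain ⟨y, hy, hyz⟩ : ∃ y ∈ ℓ', y ≠ z := by
    have := h.lt_card hℓ'
    exact Finset.exists_mem_ne (by omega) z
  obtain ⟨ℓ₂, hℓ₂, hne₂⟩ : ∃ ℓ₂ ∈ closeLines G L y x, ℓ₂ ≠ ℓ₀ := by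
    have h1 := h.card_closeLines (x := y) (y := x) (by rw [G.dist_comm]; exact hdist y hy hyz)
    have h2 := h.two_le
    exact Finset.exists_mem_ne (by omega) ℓ₀
  obtain ⟨hℓ₂L, hx₂, _⟩ := mem_closeLines.1 hℓ₂
  have hcard₂ := hx ℓ₂ hℓ₂L hx₂
  have hnot₂ : ∀ w ∈ ℓ', w ∉ ℓ₂ := by
    intro w hw hw₂
    by_cases hwz : w = z
    · subst hwz
      exact hne₂ (h.unique ℓ₂ hℓ₂L ℓ₀ hℓ₀ x w hxz.ne hx₂ hw₂ hx₀ hz₀)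
    · exact hnadj w hw hwz (h.adj ℓ₂ hℓ₂L x hx₂ w hw₂ fun hh => hxℓ' (hh ▸ hw))
  refine h.card_eq_of_near hℓ₂L hcard₂ hℓ' (Finset.disjoint_right.2 fun w hw => hnot₂ w hw)
    fun w hw => ?_
  by_cases hwz : w = z
  · subst hwz
    exact ⟨x, hx₂, hxz.symm⟩
  · have h1 := h.closeLines_eq hℓ' hxℓ' (h.dist_le_two_of_adj hℓ' hz hxz) hy hw
      (hdist y hy hyz) (hdist w hw hwz)
    rw [h1] at hℓ₂
    exact h.exists_adj hℓ₂L hcard₂ (hnot₂ w hw) (mem_closeLines.1 hℓ₂).2.2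

theorem IsFull.of_adj (h : LineData G D b α β L s) {x z : V} (hx : IsFull L β x)
    (hxz : G.Adj x z) : IsFull L β z := by
  rcases h.alpha_nonneg.eq_or_lt with h0 | h0
  · subst h0
    exact IsFull.of_adj_of_zero h hx hxz
  · exact IsFull.of_adj_of_pos h h0 hx hxz

theorem isFull (h : LineData G D b α β L s) (y : V) : IsFull L β y := by
  obtain ⟨x, hx⟩ := h.exists_isFull
  obtain ⟨p⟩ := h.connected.preconnected x y
  induction p with
  | nil => exact hx
  | cons hadj _ ih => exact ih (IsFull.of_adj h hx hadj)

theorem isGeometric (h : LineData G D b α β L s) : IsGeometric G (β + 1) := by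
  refine ⟨{C | ∃ ℓ ∈ L, ℓ.Nonempty ∧ C = (ℓ : Set V)}, ?_, ?_⟩
  · rintro _ ⟨ℓ, hℓ, ⟨x, hx⟩, rfl⟩
    refine ⟨fun y hy z hz hne => h.adj ℓ hℓ y hy z hz hne, ?_⟩
    rw [Set.ncard_coe_finset]
    exact h.isFull x ℓ hℓ hx
  · intro x y hxy
    obtain ⟨ℓ, hℓ, hx, hy⟩ := h.exists_line x y hxy
    refine ⟨ℓ, ⟨⟨ℓ, hℓ, ⟨x, hx⟩, rfl⟩, hx, hy⟩, ?_⟩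
    rintro _ ⟨⟨ℓ', hℓ', _, rfl⟩, hx', hy'⟩
    rw [h.unique ℓ' hℓ' ℓ hℓ x y hxy.ne hx' hy' hx hy]

end LineData

/-- Classical parameters satisfying the hypotheses of the main theorem. -/
theorem HasClassicalParams.largeBeta {cc aa bb : ℕ → ℕ} (hb : 2 ≤ b) (hD : 3 ≤ D)
    (h : HasClassicalParams G D b α β cc aa bb)
    (h1 : (2 * (b : ℝ) + 4) / (2 * b + 3) * gauss b D * (b + 2) * (α * b + b + α) ≤ β)
    (h2 : (2 * (b : ℝ) + 4) / (2 * b + 3) * gauss b D * ((b + 1) * (b ^ 2 + b + 2) - 3) ≤ β) :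
    LargeBeta G D b α β := by
  classical
  obtain ⟨⟨hconn, hle, ⟨x₀, y₀, hxy₀⟩, hcount⟩, hbb, hcc⟩ := h
  have hb' : (2 : ℝ) ≤ b := by exact_mod_cast hb
  have hc3 : 0 < cc 3 := by
    obtain ⟨y, hy⟩ := exists_dist_eq_of_le hconn (i := 3) (hxy₀ ▸ hD)
    obtain ⟨z, hz⟩ := exists_adj_dist_eq_of_dist_eq_succ hconn hy
    rw [← (hcount 3 hD x₀ y hy).1]
    exact (Set.ncard_pos (Set.toFinite _)).2 ⟨z, hz⟩
  have hα : α = 0 ∨ 1 ≤ α * (b + 1) := by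
    have e2 := hcc 2 (by omega) (by omega)
    have e3 := hcc 3 (by omega) (by omega)
    norm_num [gauss_one, gauss_two, gauss_three] at e2 e3
    have h3 : (0 : ℝ) < cc 3 := by exact_mod_cast hc3
    rw [e3] at h3
    have h4 : 0 < 1 + α * (b + 1) := by
      exact (pos_iff_pos_of_mul_pos h3).1 (by positivity)
    have h5 : α * (b + 1) = ((cc 2 : ℤ) - (b + 1 : ℤ) : ℤ) := by
      push_cast; rw [e2]; ring
    have h6 : (-1 : ℝ) < ((cc 2 : ℤ) - (b + 1 : ℤ) : ℤ) := by rw [← h5]; linarith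
    have h7 : (-1 : ℤ) < (cc 2 : ℤ) - (b + 1 : ℤ) := by exact_mod_cast h6
    rcases (show (cc 2 : ℤ) - (b + 1 : ℤ) = 0 ∨ 1 ≤ (cc 2 : ℤ) - (b + 1 : ℤ) by omega) with h8 | h8
    · left
      rw [h8, Int.cast_zero] at h5
      rcases mul_eq_zero.1 h5 with h9 | h9
      · exact h9
      · linarith
    · right
      rw [h5]
      exact_mod_cast h8
  refine ⟨hconn, hle, ?_, ?_, hb, hD, ?_, hα, h1, h2⟩
  · intro x y
    rcases (hle x y).lt_or_eq with h3 | h3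
    · rw [← hbb _ (by omega), ← (hcount _ (hle x y) x y rfl).2.2, Set.ncard_eq_toFinset_card']
      congr 2
      ext z
      simp
    · rw [h3, sub_self, zero_mul, Nat.cast_eq_zero, Finset.card_eq_zero, Finset.filter_eq_empty_iff]
      intro z _ hz
      have := hle x z
      omega
  · intro x y
    rcases Nat.eq_zero_or_pos (G.dist x y) with h3 | h3
    · simp [h3, gauss_zero]
    · rw [← hcc _ h3 (hle x y), ← (hcount _ (hle x y) x y rfl).1, Set.ncard_eq_toFinset_card']
      congr 2
      ext z
      simp only [Finset.mem_filter, Finset.mem_univ, true_and, Set.mem_toFinset, Set.mem_ofPred_eq]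
      exact and_congr_right fun _ => by omega
  · rcases hα with h3 | h3
    · exact h3.ge
    · by_contra h4
      push Not at h4
      nlinarith

end Conclusion

/-- if `Γ` has classical parameters `(D, b, α, β)`, `b ≥ 2`, `D ≥ 3`, and
`β ≥ max{((2b+4)/(2b+3))·r(b+2)(αb + b + α), ((2b+4)/(2b+3))·r((b+1)(b² + b + 2) - 3)}`,
then `Γ` is geometric. -/
theorem statement_12 {V : Type*} [Fintype V] (G : SimpleGraph V) (D b : ℕ) (α β : ℝ)
    (cc aa bb : ℕ → ℕ) (hb : 2 ≤ b) (hD : 3 ≤ D)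
    (h : HasClassicalParams G D b α β cc aa bb)
    (hβ : max ((2 * (b : ℝ) + 4) / (2 * (b : ℝ) + 3) * gauss b D * ((b : ℝ) + 2)
                * (α * (b : ℝ) + (b : ℝ) + α))
              ((2 * (b : ℝ) + 4) / (2 * (b : ℝ) + 3) * gauss b D
                * (((b : ℝ) + 1) * ((b : ℝ) ^ 2 + (b : ℝ) + 2) - 3)) ≤ β) :
    IsGeometric G (β + 1) := by
  obtain ⟨L, s, hL⟩ := (HasClassicalParams.largeBeta hb hD h ((le_max_left _ _).trans hβ)
    ((le_max_right _ _).trans hβ)).exists_lineData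
  exact hL.isGeometric
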